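/- arXiv:2208.06873 — 3 statements merged into one kernel-verified Lean document; each statement's English description precedes it below -/
import Mathlib

section
/- Let s ∈ (0,1), b = 1 − 2s, d_s = 2^{1−2s}·Γ(1−s)/Γ(s), λ > 0, and define ψ_{s,λ}(y) = ψ_s(√λ·y). Let η : ℝ → ℝ be an even function which is differentiable almost everywhere with η(y) = η(0) + ∫_0^y η'(t) dt for all y ∈ ℝ, and such that ∫_ℝ |y|^b·(η'(y)² + η(y)²) dy < ∞. Then ∫_ℝ |y|^b·( ψ_{s,λ}'(y)·η'(y) + λ·ψ_{s,λ}(y)·η(y) ) dy = 2·d_s·λ^s·η(0), where ψ_{s,λ}' denotes the derivative of ψ_{s,λ}, defined at every y ≠ 0. -/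
open MeasureTheory Real Filter Set

/-- The modified Bessel function of the second kind, for `y > 0` given by
`K_s(y) = ∫_0^∞ e^{−y·cosh t}·cosh(s·t) dt`. -/
noncomputable def besselK (s y : ℝ) : ℝ :=
  ∫ t in Set.Ioi (0 : ℝ), Real.exp (-(y * Real.cosh t)) * Real.cosh (s * t)

/-- `ψ_s(y) = (2^{1−s}/Γ(s))·|y|^s·K_s(|y|)` for `y ≠ 0`, and `ψ_s(0) = 1`. -/
noncomputable def psi (s : ℝ) (y : ℝ) : ℝ :=
  if y = 0 then 1
  else (2 : ℝ) ^ (1 - s) / Real.Gamma s * |y| ^ s * besselK s |y|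

lemma integrableOn_rpow_mul_exp_neg {p r : ℝ} (hp : -1 < p) (hr : 0 < r) :
    IntegrableOn (fun x : ℝ => x ^ p * Real.exp (-(r * x))) (Ioi 0) := by
  simpa using integrableOn_rpow_mul_exp_neg_mul_rpow (s := p) hp one_pos hr

/-- The heat-type integral representation `∫_0^∞ e^{-u - y²/(4u)} u^{a-1} du`,
equal to `2^{1-a} y^a K_a(y)` for `y > 0`. -/
noncomputable def besselW (a y : ℝ) : ℝ :=
  ∫ u in Ioi (0 : ℝ), Real.exp (-u - y ^ 2 / (4 * u)) * u ^ (a - 1)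

lemma measurable_besselW_integrand (a y : ℝ) :
    Measurable fun u : ℝ => Real.exp (-u - y ^ 2 / (4 * u)) * u ^ (a - 1) := by
  fun_prop

lemma besselW_nonneg (a y : ℝ) : 0 ≤ besselW a y :=
  setIntegral_nonneg measurableSet_Ioi fun u hu => by
    have : 0 < u := hu
    positivity

lemma besselW_integrand_le (a y : ℝ) {u : ℝ} (hu : 0 < u) :
    ‖Real.exp (-u - y ^ 2 / (4 * u)) * u ^ (a - 1)‖ ≤ u ^ (a - 1) * Real.exp (-(1 * u)) := by
  rw [Real.norm_of_nonneg (by positivity), mul_comm]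
  gcongr
  have : 0 ≤ y ^ 2 / (4 * u) := by positivity
  linarith

lemma integrableOn_besselW {a : ℝ} (ha : 0 < a) (y : ℝ) :
    IntegrableOn (fun u : ℝ => Real.exp (-u - y ^ 2 / (4 * u)) * u ^ (a - 1)) (Ioi 0) :=
  (integrableOn_rpow_mul_exp_neg (p := a - 1) (by linarith) one_pos).mono'
    (measurable_besselW_integrand a y).aestronglyMeasurable
    ((ae_restrict_iff' measurableSet_Ioi).2 (ae_of_all _ fun _ hu => besselW_integrand_le a y hu))

lemma continuous_besselW {a : ℝ} (ha : 0 < a) : Continuous (besselW a) := by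
  refine MeasureTheory.continuous_of_dominated
    (fun y => (measurable_besselW_integrand a y).aestronglyMeasurable)
    (fun y => (ae_restrict_iff' measurableSet_Ioi).2
      (ae_of_all _ fun _ hu => besselW_integrand_le a y hu))
    (integrableOn_rpow_mul_exp_neg (p := a - 1) (by linarith) one_pos) ?_
  exact ae_of_all _ fun u => by fun_prop

lemma besselW_zero {a : ℝ} (ha : 0 < a) : besselW a 0 = Real.Gamma a := by
  rw [Real.Gamma_eq_integral ha, besselW]
  simp

lemma exists_besselW_le {a : ℝ} (ha : 0 < a) :
    ∃ C : ℝ, ∀ y, 0 ≤ y → besselW a y ≤ C * Real.exp (-(y / 2)) := by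
  refine ⟨∫ u in Ioi (0 : ℝ), u ^ (a - 1) * Real.exp (-(1 / 2 * u)), fun y hy => ?_⟩
  rw [← integral_mul_const]
  refine setIntegral_mono_on (integrableOn_besselW ha y)
    ((integrableOn_rpow_mul_exp_neg (by linarith) (by norm_num)).mul_const _)
    measurableSet_Ioi fun u hu => ?_
  have hu : 0 < u := hu
  rw [mul_assoc, ← Real.exp_add, mul_comm]
  gcongr
  have : y / 2 - u / 2 ≤ y ^ 2 / (4 * u) := by
    rw [le_div_iff₀ (by positivity)]
    nlinarith [sq_nonneg (y - u)]
  linarith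

lemma besselW_eq_integral_exp (a : ℝ) {y : ℝ} (hy : 0 < y) :
    besselW a y = (y / 2) ^ a * ∫ t : ℝ, Real.exp (-(y * Real.cosh t)) * Real.exp (a * t) := by
  have himg : (fun t : ℝ => y / 2 * Real.exp t) '' univ = Ioi 0 := by
    ext u
    simp only [image_univ, mem_range, mem_Ioi]
    constructor
    · rintro ⟨t, rfl⟩
      positivity
    · intro hu
      refine ⟨Real.log (u / (y / 2)), ?_⟩
      rw [Real.exp_log (by positivity)]
      field_simp
  have hder : ∀ t ∈ (univ : Set ℝ), HasDerivWithinAt (fun t : ℝ => y / 2 * Real.exp t)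
      (y / 2 * Real.exp t) univ t := fun t _ =>
    ((Real.hasDerivAt_exp t).const_mul (y / 2)).hasDerivWithinAt
  have hinj : InjOn (fun t : ℝ => y / 2 * Real.exp t) univ := by
    intro t _ t' _ h
    exact Real.exp_injective (mul_left_cancel₀ (by positivity) h)
  rw [besselW, ← himg, integral_image_eq_integral_abs_deriv_smul MeasurableSet.univ hder hinj,
    setIntegral_univ, ← integral_const_mul]
  refine integral_congr_ae (ae_of_all _ fun t => ?_)
  have h1 : -(y / 2 * Real.exp t) - y ^ 2 / (4 * (y / 2 * Real.exp t)) = -(y * Real.cosh t) := by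
    rw [Real.cosh_eq, Real.exp_neg]
    field_simp
    ring
  have h2 : (y / 2 * Real.exp t) * (y / 2 * Real.exp t) ^ (a - 1)
      = (y / 2) ^ a * Real.exp (a * t) := by
    rw [Real.rpow_sub_one (by positivity), Real.mul_rpow (by positivity) (by positivity),
      ← Real.exp_mul]
    field_simp
  simp only [smul_eq_mul]
  rw [h1, abs_of_pos (by positivity), mul_left_comm, h2]
  ring

lemma integral_exp_neg_cosh_neg (a y : ℝ) :
    ∫ t : ℝ, Real.exp (-(y * Real.cosh t)) * Real.exp (-a * t)
      = ∫ t : ℝ, Real.exp (-(y * Real.cosh t)) * Real.exp (a * t) := by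
  rw [← integral_neg_eq_self]
  simp

lemma besselW_neg (a : ℝ) {y : ℝ} (hy : 0 < y) :
    besselW (-a) y = (y / 2) ^ (-(2 * a)) * besselW a y := by
  rw [besselW_eq_integral_exp _ hy, besselW_eq_integral_exp _ hy, integral_exp_neg_cosh_neg,
    ← mul_assoc, ← Real.rpow_add (by positivity)]
  ring_nf

lemma integrable_exp_neg_cosh {a y : ℝ} (ha : 0 < a) (hy : 0 < y) :
    Integrable fun t : ℝ => Real.exp (-(y * Real.cosh t)) * Real.exp (a * t) := by
  by_contra h
  have h1 := besselW_eq_integral_exp a hy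
  rw [integral_undef h, mul_zero] at h1
  have : 0 < besselW a y := by
    refine (setIntegral_pos_iff_support_of_nonneg_ae ?_ (integrableOn_besselW ha y)).2 ?_
    · exact (ae_restrict_iff' measurableSet_Ioi).2 (ae_of_all _ fun u hu => by
        have : 0 < u := hu
        simp only [Pi.zero_apply]
        positivity)
    · refine lt_of_lt_of_le ?_ (measure_mono (s := Ioi 0) fun u hu => ⟨?_, hu⟩)
      · simp
      · have : 0 < u := hu
        simp only [Function.mem_support]
        positivity
  exact this.ne' h1

lemma besselW_eq_besselK {a y : ℝ} (ha : 0 < a) (hy : 0 < y) :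
    besselW a y = 2 * (y / 2) ^ a * besselK a y := by
  have h0 := integral_comp_abs (f := fun t => Real.exp (-(y * Real.cosh t)) * Real.cosh (a * t))
  have habs : ∀ t : ℝ, Real.exp (-(y * Real.cosh |t|)) * Real.cosh (a * |t|)
      = (Real.exp (-(y * Real.cosh t)) * Real.exp (a * t)
        + Real.exp (-(y * Real.cosh t)) * Real.exp (-a * t)) / 2 := by
    intro t
    rw [Real.cosh_abs, ← Real.cosh_abs (a * |t|), abs_mul, abs_abs, ← abs_mul, Real.cosh_abs,
      Real.cosh_eq (a * t), neg_mul]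
    ring
  have hint := integrable_exp_neg_cosh ha hy
  have hint' : Integrable fun t : ℝ => Real.exp (-(y * Real.cosh t)) * Real.exp (-a * t) := by
    simpa using hint.comp_neg
  simp_rw [habs] at h0
  rw [integral_div, integral_add hint hint', integral_exp_neg_cosh_neg] at h0
  rw [besselW_eq_integral_exp _ hy, besselK]
  linear_combination (y / 2) ^ a * h0

lemma psi_eq_besselW {s y : ℝ} (hs : 0 < s) (hy : 0 < y) :
    psi s y = besselW s y / Real.Gamma s := by
  rw [psi, if_neg hy.ne', abs_of_pos hy, besselW_eq_besselK hs hy,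
    Real.div_rpow hy.le zero_le_two, Real.rpow_sub two_pos, Real.rpow_one]
  field_simp

lemma hasDerivAt_besselW {a y : ℝ} (ha : 0 < a) (hy : 0 < y) :
    HasDerivAt (besselW a) (-(y / 2) ^ (2 * a - 1) * besselW (1 - a) y) y := by
  have hF : ∀ u ∈ Ioi (0 : ℝ), ∀ x : ℝ,
      HasDerivAt (fun x => Real.exp (-u - x ^ 2 / (4 * u)) * u ^ (a - 1))
        (-(x / 2) * (Real.exp (-u - x ^ 2 / (4 * u)) * u ^ (a - 1 - 1))) x := by
    intro u hu x
    have hu : 0 < u := hu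
    have h := ((((hasDerivAt_pow 2 x).div_const (4 * u)).const_sub (-u)).exp).mul_const
      (u ^ (a - 1))
    refine h.congr_deriv ?_
    rw [Real.rpow_sub_one hu.ne' (a - 1)]
    push_cast
    field_simp
    ring
  have key := hasDerivAt_integral_of_dominated_loc_of_deriv_le (μ := volume.restrict (Ioi 0))
    (F := fun x u => Real.exp (-u - x ^ 2 / (4 * u)) * u ^ (a - 1))
    (F' := fun x u => -(x / 2) * (Real.exp (-u - x ^ 2 / (4 * u)) * u ^ (a - 1 - 1)))
    (bound := fun u => 16 / y * (u ^ (a - 1) * Real.exp (-(1 * u))))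
    (x₀ := y) (Ioo_mem_nhds (show y / 2 < y by linarith) (show y < 2 * y by linarith))
    (Eventually.of_forall fun x => (measurable_besselW_integrand a x).aestronglyMeasurable)
    (integrableOn_besselW ha y)
    ((measurable_besselW_integrand (a - 1) y).const_mul _).aestronglyMeasurable
    ((ae_restrict_iff' measurableSet_Ioi).2 (ae_of_all _ fun u hu x hx => ?_))
    ((integrableOn_rpow_mul_exp_neg (by linarith) one_pos).const_mul _)
    ((ae_restrict_iff' measurableSet_Ioi).2 (ae_of_all _ fun u hu x _ => hF u hu x))
  · refine key.2.congr_deriv ?_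
    rw [integral_const_mul]
    change -(y / 2) * besselW (a - 1) y = _
    rw [show a - 1 = -(1 - a) by ring, besselW_neg _ hy,
      show -(2 * (1 - a)) = 2 * a - 1 - 1 by ring, Real.rpow_sub_one (by positivity)]
    field_simp
  · have hu : 0 < u := hu
    obtain ⟨hx1, hx2⟩ := hx
    have hx0 : 0 < x := by linarith
    rw [neg_mul, norm_neg, Real.norm_of_nonneg (by positivity), Real.rpow_sub_one hu.ne',
      sub_eq_add_neg, Real.exp_add, one_mul]
    have hexp : Real.exp (-(x ^ 2 / (4 * u))) ≤ 16 * u / y ^ 2 := by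
      have h1 : x ^ 2 / (4 * u) ≤ Real.exp (x ^ 2 / (4 * u)) := by
        linarith [Real.add_one_le_exp (x ^ 2 / (4 * u))]
      rw [Real.exp_neg]
      calc (Real.exp (x ^ 2 / (4 * u)))⁻¹ ≤ (x ^ 2 / (4 * u))⁻¹ := by gcongr
        _ = 4 * u / x ^ 2 := by rw [inv_div]
        _ ≤ 4 * u / (y / 2) ^ 2 := by gcongr
        _ = 16 * u / y ^ 2 := by field_simp; norm_num
    calc x / 2 * (Real.exp (-u) * Real.exp (-(x ^ 2 / (4 * u))) * (u ^ (a - 1) / u))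
        ≤ (2 * y) / 2 * (Real.exp (-u) * (16 * u / y ^ 2) * (u ^ (a - 1) / u)) := by gcongr
      _ = 16 / y * (u ^ (a - 1) * Real.exp (-u)) := by field_simp

/-- Integration by parts on `(0, ∞)` for a decreasing profile `P` with derivative `-q`
against a primitive of `g`. -/
lemma integral_mul_primitive {P q g η : ℝ → ℝ}
    (hcont : ContinuousOn P (Ici 0)) (hderiv : ∀ x ∈ Ioi (0 : ℝ), HasDerivAt P (-q x) x)
    (hq : ∀ x ∈ Ioi (0 : ℝ), 0 ≤ q x) (hlim : Tendsto P atTop (nhds 0))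
    (hg : Measurable g) (hPg : IntegrableOn (fun x => P x * g x) (Ioi 0))
    (hη : ∀ y ∈ Ioi (0 : ℝ), η y = η 0 + ∫ t in (0 : ℝ)..y, g t) :
    IntegrableOn (fun x => q x * η x) (Ioi 0) ∧
      ∫ x in Ioi (0 : ℝ), q x * η x = P 0 * η 0 + ∫ x in Ioi (0 : ℝ), P x * g x := by
  have hcw : ∀ t, 0 ≤ t → ContinuousWithinAt P (Ici t) t := fun t ht =>
    (hcont t ht).mono (Ici_subset_Ici.2 ht)
  have hqi : ∀ t, 0 ≤ t → IntegrableOn q (Ioi t) := fun t ht => by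
    have h := integrableOn_Ioi_deriv_of_nonpos (hcw t ht)
      (fun x hx => hderiv x (lt_of_le_of_lt ht hx))
      (fun x hx => neg_nonpos.2 (hq x (lt_of_le_of_lt ht hx))) hlim
    simpa using h.neg
  have hqint : ∀ t, 0 ≤ t → ∫ x in Ioi t, q x = P t := fun t ht => by
    have h := integral_Ioi_of_hasDerivAt_of_tendsto (hcw t ht)
      (fun x hx => hderiv x (lt_of_le_of_lt ht hx)) (hqi t ht).neg hlim
    rw [integral_neg] at h
    linarith
  have hP : ∀ t, 0 ≤ t → 0 ≤ P t := fun t ht => by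
    rw [← hqint t ht]
    exact setIntegral_nonneg measurableSet_Ioi fun x hx => hq x (lt_of_le_of_lt ht hx)
  set μ : Measure ℝ := volume.restrict (Ioi 0) with hμ
  let H : ℝ → ℝ → ℝ := fun t y => (Ioi t).indicator (fun y => q y * g t) y
  have hHm : AEStronglyMeasurable (Function.uncurry H) (μ.prod μ) := by
    have h1 : AEStronglyMeasurable (fun z : ℝ × ℝ => q z.2 * g z.1) (μ.prod μ) :=
      ((hqi 0 le_rfl).aestronglyMeasurable.comp_snd).mul
        hg.aestronglyMeasurable.comp_fst
    exact h1.indicator (measurableSet_lt measurable_fst measurable_snd)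
  have hrest : ∀ t, 0 < t → μ.restrict (Ioi t) = volume.restrict (Ioi t) := fun t ht => by
    rw [hμ, Measure.restrict_restrict measurableSet_Ioi,
      inter_eq_left.2 (Ioi_subset_Ioi ht.le)]
  have hHint : Integrable (Function.uncurry H) (μ.prod μ) := by
    refine (integrable_prod_iff hHm).2 ⟨?_, ?_⟩
    · refine (ae_restrict_iff' measurableSet_Ioi).2 (ae_of_all _ fun t ht => ?_)
      change Integrable ((Ioi t).indicator fun y => q y * g t) μ
      rw [integrable_indicator_iff measurableSet_Ioi, IntegrableOn, hrest t ht]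
      exact (hqi t (le_of_lt ht)).mul_const _
    · refine (integrable_congr ?_).2 hPg.norm
      refine (ae_restrict_iff' measurableSet_Ioi).2 (ae_of_all _ fun t ht => ?_)
      have ht : 0 < t := ht
      change ∫ y, ‖(Ioi t).indicator (fun y => q y * g t) y‖ ∂μ = ‖P t * g t‖
      simp_rw [norm_indicator_eq_indicator_norm]
      rw [integral_indicator measurableSet_Ioi, hrest t ht, norm_mul,
        Real.norm_of_nonneg (hP t ht.le), ← hqint t ht.le, ← integral_mul_const]
      refine setIntegral_congr_fun measurableSet_Ioi fun y hy => ?_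
      simp only [norm_mul]
      rw [Real.norm_of_nonneg (hq y (lt_trans ht hy))]
  have hinner : ∀ y ∈ Ioi (0 : ℝ), ∫ t, H t y ∂μ = q y * η y - q y * η 0 := fun y hy => by
    have hy : 0 < y := hy
    have : (fun t => H t y) = (Iio y).indicator fun t => q y * g t := by
      ext t
      simp [H, indicator_apply]
    rw [this, integral_indicator measurableSet_Iio, hμ,
      Measure.restrict_restrict measurableSet_Iio, inter_comm, Ioi_inter_Iio,
      ← integral_Ioc_eq_integral_Ioo, ← intervalIntegral.integral_of_le hy.le,
      intervalIntegral.integral_const_mul, hη y hy]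
    ring
  have houter : ∀ t ∈ Ioi (0 : ℝ), ∫ y, H t y ∂μ = P t * g t := fun t ht => by
    have ht : 0 < t := ht
    rw [integral_indicator measurableSet_Ioi, hrest t ht, integral_mul_const, hqint t ht.le]
  have hswap := integral_integral_swap hHint
  rw [setIntegral_congr_fun measurableSet_Ioi houter,
    setIntegral_congr_fun measurableSet_Ioi hinner] at hswap
  have hdiff : Integrable (fun y => q y * η y - q y * η 0) μ := by
    refine (integrable_congr ?_).1 hHint.integral_prod_right
    exact (ae_restrict_iff' measurableSet_Ioi).2 (ae_of_all _ hinner)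
  have hc : Integrable (fun y => q y * η 0) μ := (hqi 0 le_rfl).mul_const _
  have hqη : Integrable (fun y => q y * η y) μ :=
    (hdiff.add hc).congr (ae_of_all _ fun y => by simp)
  refine ⟨hqη, ?_⟩
  rw [integral_sub hqη hc, integral_mul_const, hqint 0 le_rfl] at hswap
  linarith

lemma psi_neg (s y : ℝ) : psi s (-y) = psi s y := by
  simp [psi]

/-- The weighted flux `-y^{1-2s} ψ_{s,λ}'(y)` on `y > 0`, with `c = √λ`. -/
noncomputable def psiFlux (s c y : ℝ) : ℝ :=
  c ^ (2 * s) * 2 ^ (1 - 2 * s) / Real.Gamma s * besselW (1 - s) (c * y)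

section
variable {s c : ℝ}

lemma rpow_mul_deriv_psi (hs : 0 < s) (hc : 0 < c) {y : ℝ} (hy : 0 < y) :
    y ^ (1 - 2 * s) * deriv (fun t => psi s (c * t)) y = -psiFlux s c y := by
  have hev : (fun t => psi s (c * t)) =ᶠ[nhds y] fun t => besselW s (c * t) / Real.Gamma s := by
    filter_upwards [lt_mem_nhds hy] with t ht
    exact psi_eq_besselW hs (by positivity)
  have hd := ((hasDerivAt_besselW hs (mul_pos hc hy)).comp y
    ((hasDerivAt_id y).const_mul c)).div_const (Real.Gamma s)
  have hd' : deriv (fun t => psi s (c * t)) y = _ := hev.deriv_eq.trans hd.deriv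
  rw [hd', psiFlux, show 2 * s - 1 = -(1 - 2 * s) by ring, Real.rpow_neg (by positivity),
    Real.div_rpow (by positivity) (by positivity), Real.mul_rpow hc.le hy.le,
    show 2 * s = 1 - (1 - 2 * s) by ring, Real.rpow_sub hc 1, Real.rpow_one]
  have hcb : c ^ (1 - 2 * s) ≠ 0 := by positivity
  have hyb : y ^ (1 - 2 * s) ≠ 0 := by positivity
  have h2b : (2 : ℝ) ^ (1 - 2 * s) ≠ 0 := by positivity
  have hΓ : Real.Gamma s ≠ 0 := (Real.Gamma_pos_of_pos hs).ne'
  simp only [sub_sub_cancel, mul_one]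
  field_simp

lemma hasDerivAt_psiFlux (hs : 0 < s) (hs1 : s < 1) (hc : 0 < c) {y : ℝ} (hy : 0 < y) :
    HasDerivAt (psiFlux s c) (-(y ^ (1 - 2 * s) * (c ^ 2 * psi s (c * y)))) y := by
  have hd := ((hasDerivAt_besselW (sub_pos.2 hs1) (mul_pos hc hy)).comp y
    ((hasDerivAt_id y).const_mul c)).const_mul
      (c ^ (2 * s) * 2 ^ (1 - 2 * s) / Real.Gamma s)
  refine HasDerivAt.congr_deriv hd ?_
  rw [psi_eq_besselW hs (mul_pos hc hy), show 2 * (1 - s) - 1 = 1 - 2 * s by ring,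
    Real.div_rpow (by positivity) (by positivity), Real.mul_rpow hc.le hy.le,
    show c ^ (2 * s) = c ^ (1 - (1 - 2 * s)) by ring_nf, Real.rpow_sub hc 1, Real.rpow_one]
  have hcb : c ^ (1 - 2 * s) ≠ 0 := by positivity
  have h2b : (2 : ℝ) ^ (1 - 2 * s) ≠ 0 := by positivity
  have hΓ : Real.Gamma s ≠ 0 := (Real.Gamma_pos_of_pos hs).ne'
  simp only [sub_sub_cancel, mul_one]
  field_simp

lemma continuous_psiFlux (hs1 : s < 1) : Continuous (psiFlux s c) :=
  ((continuous_besselW (sub_pos.2 hs1)).comp (continuous_const.mul continuous_id)).const_mul _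

lemma psiFlux_zero (hs1 : s < 1) :
    psiFlux s c 0 = 2 ^ (1 - 2 * s) * Real.Gamma (1 - s) / Real.Gamma s * c ^ (2 * s) := by
  rw [psiFlux, mul_zero, besselW_zero (sub_pos.2 hs1)]
  ring

lemma psiFlux_nonneg (hs : 0 < s) (hc : 0 < c) (y : ℝ) : 0 ≤ psiFlux s c y := by
  have := besselW_nonneg (1 - s) (c * y)
  have := Real.Gamma_pos_of_pos hs
  unfold psiFlux
  positivity

lemma exists_psiFlux_le (hs : 0 < s) (hs1 : s < 1) (hc : 0 < c) :
    ∃ C : ℝ, ∀ y, 0 ≤ y → psiFlux s c y ≤ C * Real.exp (-(c / 2 * y)) := by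
  obtain ⟨C, hC⟩ := exists_besselW_le (sub_pos.2 hs1)
  refine ⟨c ^ (2 * s) * 2 ^ (1 - 2 * s) / Real.Gamma s * C, fun y hy => ?_⟩
  have := Real.Gamma_pos_of_pos hs
  rw [psiFlux, mul_assoc _ C, show c / 2 * y = c * y / 2 by ring]
  gcongr
  exact hC (c * y) (by positivity)

lemma tendsto_psiFlux (hs : 0 < s) (hs1 : s < 1) (hc : 0 < c) :
    Tendsto (psiFlux s c) atTop (nhds 0) := by
  obtain ⟨C, hC⟩ := exists_psiFlux_le hs hs1 hc
  have hlim : Tendsto (fun y => C * Real.exp (-(c / 2 * y))) atTop (nhds (C * 0)) :=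
    (Real.tendsto_exp_neg_atTop_nhds_zero.comp
      (tendsto_id.const_mul_atTop (half_pos hc))).const_mul C
  rw [mul_zero] at hlim
  exact squeeze_zero' (Eventually.of_forall (psiFlux_nonneg hs hc))
    ((eventually_ge_atTop 0).mono hC) hlim

lemma integrableOn_psiFlux_mul (hs : 0 < s) (hs1 : s < 1) (hc : 0 < c) {g : ℝ → ℝ}
    (hg : Measurable g) (hint : IntegrableOn (fun y => y ^ (1 - 2 * s) * g y ^ 2) (Ioi 0)) :
    IntegrableOn (fun y => psiFlux s c y * g y) (Ioi 0) := by
  obtain ⟨C, hC⟩ := exists_psiFlux_le hs hs1 hc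
  have hexp : IntegrableOn (fun y : ℝ => C ^ 2 * (y ^ (-(1 - 2 * s)) * Real.exp (-(c * y))))
      (Ioi 0) := (integrableOn_rpow_mul_exp_neg (by linarith) hc).const_mul _
  refine (hexp.add hint).mono'
    ((continuous_psiFlux hs1).measurable.mul hg).aestronglyMeasurable
    ((ae_restrict_iff' measurableSet_Ioi).2 (ae_of_all _ fun y hy => ?_))
  have hy : 0 < y := hy
  have hw : 0 < y ^ (1 - 2 * s) := by positivity
  have hP0 := psiFlux_nonneg hs hc y
  have hsq : psiFlux s c y ^ 2 ≤ C ^ 2 * Real.exp (-(c * y)) := by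
    calc psiFlux s c y ^ 2 ≤ (C * Real.exp (-(c / 2 * y))) ^ 2 :=
          pow_le_pow_left₀ hP0 (hC y hy.le) 2
      _ = C ^ 2 * Real.exp (-(c * y)) := by
          rw [mul_pow, ← Real.exp_nat_mul]
          congr 2
          push_cast
          ring
  rw [norm_mul, Real.norm_of_nonneg hP0, Real.norm_eq_abs, Pi.add_apply,
    Real.rpow_neg hy.le]
  set w := y ^ (1 - 2 * s)
  have hyoung : psiFlux s c y * |g y| ≤ w⁻¹ * psiFlux s c y ^ 2 + w * g y ^ 2 := by
    have h1 : 0 ≤ w⁻¹ * (psiFlux s c y - w * |g y|) ^ 2 := by positivity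
    have h2 : w⁻¹ * (psiFlux s c y - w * |g y|) ^ 2
        = w⁻¹ * psiFlux s c y ^ 2 - 2 * (psiFlux s c y * |g y|) + w * g y ^ 2 := by
      rw [← sq_abs (g y)]
      field_simp
      ring
    have h3 : 0 ≤ psiFlux s c y * |g y| := by positivity
    linarith
  calc psiFlux s c y * |g y| ≤ w⁻¹ * psiFlux s c y ^ 2 + w * g y ^ 2 := hyoung
    _ ≤ w⁻¹ * (C ^ 2 * Real.exp (-(c * y))) + w * g y ^ 2 := by gcongr
    _ = C ^ 2 * (w⁻¹ * Real.exp (-(c * y))) + w * g y ^ 2 := by ring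

end

lemma deriv_neg_of_even {f : ℝ → ℝ} (hf : ∀ y, f (-y) = f y) (y : ℝ) :
    deriv f (-y) = -deriv f y := by
  have h := deriv_comp_neg f y
  simp only [hf] at h
  rw [h, neg_neg]

/-- for `s ∈ (0,1)`, `b = 1 − 2s`, `d_s = 2^{1−2s}·Γ(1−s)/Γ(s)`, `λ > 0`
and `ψ_{s,λ}(y) = ψ_s(√λ·y)`: for every even, a.e. differentiable `η` satisfying the
fundamental theorem of calculus and with finite weighted energy,
`∫ |y|^b·(ψ_{s,λ}'·η' + λ·ψ_{s,λ}·η) dy = 2·d_s·λ^s·η(0)`. -/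
theorem psi_weak_equation (s : ℝ) (hs0 : 0 < s) (hs1 : s < 1)
    (b : ℝ) (hb : b = 1 - 2 * s)
    (d : ℝ) (hd : d = (2 : ℝ) ^ (1 - 2 * s) * Real.Gamma (1 - s) / Real.Gamma s)
    (lam : ℝ) (hlam : 0 < lam)
    (η : ℝ → ℝ)
    (hησ : ∀ y : ℝ, η (-y) = η y)
    (hηd : ∀ᵐ y : ℝ ∂volume, DifferentiableAt ℝ η y)
    (hηftc : ∀ y : ℝ, η y = η 0 + ∫ t in (0 : ℝ)..y, deriv η t)
    (hηint : Integrable (fun y : ℝ => |y| ^ b * ((deriv η y) ^ 2 + (η y) ^ 2))) :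
    ∫ y : ℝ, |y| ^ b *
        (deriv (fun t => psi s (Real.sqrt lam * t)) y * deriv η y
          + lam * psi s (Real.sqrt lam * y) * η y)
      = 2 * d * lam ^ s * η 0 := by
  subst hb hd
  set c := Real.sqrt lam with hcdef
  have hc : 0 < c := Real.sqrt_pos.2 hlam
  have hc2 : c ^ 2 = lam := Real.sq_sqrt hlam.le
  have hclam : c ^ (2 * s) = lam ^ s := by
    rw [Real.rpow_mul hc.le, Real.rpow_two, hc2]
  set f : ℝ → ℝ := fun y => |y| ^ (1 - 2 * s) *
    (deriv (fun t => psi s (c * t)) y * deriv η y + lam * psi s (c * y) * η y) with hf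
  have hψe : ∀ y, psi s (c * -y) = psi s (c * y) := fun y => by
    rw [mul_neg, psi_neg]
  have hfe : ∀ y, f |y| = f y := fun y => by
    rcases abs_choice y with h | h
    · rw [h]
    · rw [h]
      simp only [hf]
      rw [abs_neg, deriv_neg_of_even hψe, deriv_neg_of_even hησ, hψe, hησ]
      ring
  have hη'int : IntegrableOn (fun y => y ^ (1 - 2 * s) * deriv η y ^ 2) (Ioi 0) := by
    refine hηint.integrableOn.mono' (by fun_prop)
      ((ae_restrict_iff' measurableSet_Ioi).2 (ae_of_all _ fun y hy => ?_))
    have hy : 0 < y := hy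
    rw [Real.norm_of_nonneg (by positivity), abs_of_pos hy]
    gcongr
    linarith [sq_nonneg (η y)]
  have hPg := integrableOn_psiFlux_mul hs0 hs1 hc (measurable_deriv η) hη'int
  obtain ⟨hqη, hparts⟩ := integral_mul_primitive (P := psiFlux s c)
    (q := fun y => y ^ (1 - 2 * s) * (c ^ 2 * psi s (c * y))) (η := η)
    (continuous_psiFlux hs1).continuousOn
    (fun y hy => hasDerivAt_psiFlux hs0 hs1 hc hy)
    (fun y hy => by
      have hy : 0 < y := hy
      have h1 := besselW_nonneg s (c * y)
      have h2 := Real.Gamma_pos_of_pos hs0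
      rw [psi_eq_besselW hs0 (mul_pos hc hy)]
      positivity)
    (tendsto_psiFlux hs0 hs1 hc) (measurable_deriv η) hPg (fun y _ => hηftc y)
  have hfP : ∀ y ∈ Ioi (0 : ℝ), f y = y ^ (1 - 2 * s) * (c ^ 2 * psi s (c * y)) * η y
      - psiFlux s c y * deriv η y := fun y hy => by
    have h := rpow_mul_deriv_psi hs0 hc hy
    simp only [hf]
    rw [abs_of_pos hy, hc2]
    linear_combination deriv η y * h
  calc ∫ y, f y = ∫ y, f |y| := by simp_rw [hfe]
    _ = 2 * ∫ y in Ioi (0 : ℝ), f y := integral_comp_abs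
    _ = 2 * (psiFlux s c 0 * η 0) := by
      rw [setIntegral_congr_fun measurableSet_Ioi hfP, integral_sub hqη hPg, hparts]
      ring
    _ = _ := by
      rw [psiFlux_zero hs1, hclam]
      ring
end

section
/- Let s ∈ (0,1), b = 1 − 2s, d_s = 2^{1−2s}·Γ(1−s)/Γ(s), λ > 0, and define ψ_{s,λ}(y) = ψ_s(√λ·y). Then: (a) ∫_ℝ |y|^b·( ψ_{s,λ}'(y)² + λ·ψ_{s,λ}(y)² ) dy = 2·d_s·λ^s; and (b) for every even function η : ℝ → ℝ which is differentiable almost everywhere with η(y) = η(0) + ∫_0^y η'(t) dt for all y, satisfies ∫_ℝ |y|^b·(η'(y)² + η(y)²) dy < ∞, and has η(0) = 1, one has ∫_ℝ |y|^b·( η'(y)² + λ·η(y)² ) dy ≥ 2·d_s·λ^s. In particular ψ_{s,λ} minimizes the weighted energy among such η. -/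
open MeasureTheory Real Filter Set

/-- The integral `∫_0^∞ e^{−w−y²/(4w)}·w^{a−1} dw`, which equals `2^{1−a}·y^a·K_a(y)` for `y > 0`. -/
noncomputable def besselG (a y : ℝ) : ℝ :=
  ∫ w in Set.Ioi (0 : ℝ), Real.exp (-w - y ^ 2 / (4 * w)) * w ^ (a - 1)

theorem aestronglyMeasurable_besselG_integrand (a y : ℝ) :
    AEStronglyMeasurable (fun w : ℝ => Real.exp (-w - y ^ 2 / (4 * w)) * w ^ (a - 1))
      (volume.restrict (Ioi 0)) :=
  Measurable.aestronglyMeasurable (by fun_prop)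

theorem norm_besselG_integrand_le (a y : ℝ) {w : ℝ} (hw : 0 < w) :
    ‖Real.exp (-w - y ^ 2 / (4 * w)) * w ^ (a - 1)‖ ≤ Real.exp (-w) * w ^ (a - 1) := by
  rw [Real.norm_of_nonneg (by positivity)]
  gcongr
  have : 0 ≤ y ^ 2 / (4 * w) := by positivity
  linarith

theorem integrableOn_besselG_integrand {a : ℝ} (ha : 0 < a) (y : ℝ) :
    IntegrableOn (fun w : ℝ => Real.exp (-w - y ^ 2 / (4 * w)) * w ^ (a - 1)) (Ioi 0) := by
  refine (Real.GammaIntegral_convergent ha).mono' (aestronglyMeasurable_besselG_integrand a y) ?_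
  filter_upwards [ae_restrict_mem measurableSet_Ioi] with w hw
  exact norm_besselG_integrand_le a y hw

theorem continuous_besselG {a : ℝ} (ha : 0 < a) : Continuous (besselG a) := by
  refine continuous_of_dominated (aestronglyMeasurable_besselG_integrand a) (fun y => ?_)
    (Real.GammaIntegral_convergent ha) ?_
  · filter_upwards [ae_restrict_mem measurableSet_Ioi] with w hw
    exact norm_besselG_integrand_le a y hw
  · exact Eventually.of_forall fun w => by fun_prop

theorem besselG_zero {a : ℝ} (ha : 0 < a) : besselG a 0 = Real.Gamma a := by
  simp [besselG, Real.Gamma_eq_integral ha]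

theorem besselG_neg (a y : ℝ) : besselG a (-y) = besselG a y := by
  simp [besselG]

theorem tendsto_besselG_atTop {a : ℝ} (ha : 0 < a) : Tendsto (besselG a) atTop (nhds 0) := by
  have h := tendsto_integral_filter_of_dominated_convergence (l := atTop)
    (μ := volume.restrict (Ioi (0 : ℝ)))
    (F := fun (y w : ℝ) => Real.exp (-w - y ^ 2 / (4 * w)) * w ^ (a - 1)) (f := fun _ => 0) _
    (Eventually.of_forall (aestronglyMeasurable_besselG_integrand a))
    (Eventually.of_forall fun y => by
      filter_upwards [ae_restrict_mem measurableSet_Ioi] with w hw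
      exact norm_besselG_integrand_le a y hw)
    (Real.GammaIntegral_convergent ha) ?_
  · rw [integral_zero] at h
    exact h
  · filter_upwards [ae_restrict_mem measurableSet_Ioi] with w hw
    have hw : (0 : ℝ) < w := hw
    have h1 : Tendsto (fun y : ℝ => y ^ 2 / (4 * w)) atTop atTop :=
      (tendsto_pow_atTop two_ne_zero).atTop_div_const (by positivity)
    have h2 : Tendsto (fun y : ℝ => -w - y ^ 2 / (4 * w)) atTop atBot :=
      tendsto_atBot_add_const_left _ (-w) (tendsto_neg_atTop_atBot.comp h1)
    simpa using (Real.tendsto_exp_atBot.comp h2).mul_const (w ^ (a - 1))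

theorem hasDerivAt_besselG {a y : ℝ} (ha : 0 < a) (hy : 0 < y) :
    HasDerivAt (besselG a) (-(y / 2) * besselG (a - 1) y) y := by
  have h := hasDerivAt_integral_of_dominated_loc_of_deriv_le
    (μ := volume.restrict (Ioi (0 : ℝ))) (x₀ := y) (s := Ioi (y / 2))
    (F := fun (y w : ℝ) => Real.exp (-w - y ^ 2 / (4 * w)) * w ^ (a - 1))
    (F' := fun (y w : ℝ) =>
      -(y / 2) * (Real.exp (-w - y ^ 2 / (4 * w)) * w ^ (a - 1 - 1)))
    (bound := fun w => 4 / y * (Real.exp (-w) * w ^ (a - 1)))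
    (Ioi_mem_nhds (by linarith))
    (Eventually.of_forall (aestronglyMeasurable_besselG_integrand a))
    (integrableOn_besselG_integrand ha y)
    ((aestronglyMeasurable_besselG_integrand (a - 1) y).const_mul _)
    ?_ ((Real.GammaIntegral_convergent ha).const_mul _) ?_
  · rw [besselG, ← integral_const_mul]
    exact h.2
  · filter_upwards [ae_restrict_mem measurableSet_Ioi] with w hw x hx
    have hw : (0 : ℝ) < w := hw
    have hx : y / 2 < x := hx
    have hx0 : 0 < x := by linarith
    have hexp : Real.exp (-(x ^ 2 / (4 * w))) ≤ 4 * w / x ^ 2 := by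
      rw [Real.exp_neg, ← inv_div (x ^ 2)]
      refine inv_anti₀ (by positivity) ?_
      linarith [Real.add_one_le_exp (x ^ 2 / (4 * w))]
    rw [norm_mul, norm_neg, Real.norm_of_nonneg (by positivity),
      Real.norm_of_nonneg (by positivity), sub_eq_add_neg, Real.exp_add,
      Real.rpow_sub_one hw.ne' (a - 1)]
    calc x / 2 * (Real.exp (-w) * Real.exp (-(x ^ 2 / (4 * w))) * (w ^ (a - 1) / w))
        ≤ x / 2 * (Real.exp (-w) * (4 * w / x ^ 2) * (w ^ (a - 1) / w)) := by gcongr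
      _ = 2 / x * (Real.exp (-w) * w ^ (a - 1)) := by field_simp; ring
      _ ≤ 4 / y * (Real.exp (-w) * w ^ (a - 1)) := by
        gcongr ?_ * _
        rw [div_le_div_iff₀ hx0 hy]
        linarith
  · filter_upwards [ae_restrict_mem measurableSet_Ioi] with w hw x _
    have hw : (0 : ℝ) < w := hw
    have h1 : HasDerivAt (fun x : ℝ => -w - x ^ 2 / (4 * w)) (-(2 * x / (4 * w))) x := by
      simpa using ((hasDerivAt_pow 2 x).div_const (4 * w)).const_sub (-w)
    refine (h1.exp.mul_const (w ^ (a - 1))).congr_deriv ?_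
    rw [Real.rpow_sub_one hw.ne' (a - 1)]
    field_simp
    ring

theorem besselG_neg_left (a : ℝ) {y : ℝ} (hy : 0 < y) :
    besselG (-a) y = (y ^ 2 / 4) ^ (-a) * besselG a y := by
  set c := y ^ 2 / 4 with hc
  have hc0 : 0 < c := by positivity
  have hcw : ∀ w : ℝ, y ^ 2 / (4 * w) = c / w := fun w => by rw [hc, div_div]
  simp only [besselG, hcw]
  have h1 := integral_comp_rpow_Ioi
    (fun v => c * (Real.exp (-(c * v) - c / (c * v)) * (c * v) ^ (-a - 1))) (p := -1) (by norm_num)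
  have h2 := integral_comp_mul_left_Ioi'
    (fun w => Real.exp (-w - c / w) * w ^ (-a - 1)) 0 hc0
  rw [mul_zero] at h2
  rw [← h2, smul_eq_mul, ← integral_const_mul, ← h1, ← integral_const_mul]
  refine setIntegral_congr_fun measurableSet_Ioi fun w hw => ?_
  have hw : (0 : ℝ) < w := hw
  simp only [smul_eq_mul, abs_neg, abs_one, one_mul, Real.rpow_neg_one]
  have e1 : -(c * w⁻¹) - c / (c * w⁻¹) = -w - c / w := by field_simp; ring
  have e2 : (c * w⁻¹) ^ (-a - 1) = c ^ (-a) / c * (w ^ (a - 1) * w ^ (2 : ℝ)) := by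
    rw [Real.mul_rpow hc0.le (by positivity), Real.rpow_sub_one hc0.ne', Real.inv_rpow hw.le,
      ← Real.rpow_neg hw.le, ← Real.rpow_add hw]
    congr 2
    ring
  have e3 : w ^ (-1 - 1 : ℝ) = (w ^ (2 : ℝ))⁻¹ := by
    rw [← Real.rpow_neg hw.le]; norm_num
  rw [e1, e2, e3]
  have : w ^ (2 : ℝ) ≠ 0 := (Real.rpow_pos_of_pos hw _).ne'
  field_simp

theorem rpow_mul_besselK {a y : ℝ} (ha : 0 < a) (hy : 0 < y) :
    y ^ a * besselK a y = 2 ^ (a - 1) * besselG a y := by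
  set g : ℝ → ℝ := fun w => Real.exp (-w - y ^ 2 / (4 * w)) * w ^ (a - 1) with hg
  set f : ℝ → ℝ := fun t => y / 2 * Real.exp t with hf
  set φ : ℝ → ℝ := fun t => Real.exp (-(y * Real.cosh t)) * Real.exp (a * t) with hφ
  have himg : f '' univ = Ioi 0 := by
    ext w
    simp only [image_univ, mem_range, mem_Ioi, hf]
    constructor
    · rintro ⟨t, rfl⟩
      positivity
    · intro hw
      refine ⟨Real.log (2 * w / y), ?_⟩
      rw [Real.exp_log (by positivity)]
      field_simp
  have hder : ∀ t ∈ univ, HasDerivWithinAt f (f t) univ t := fun t _ =>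
    ((Real.hasDerivAt_exp t).const_mul (y / 2)).hasDerivWithinAt
  have hinj : InjOn f univ := fun t _ t' _ h =>
    Real.exp_injective (mul_left_cancel₀ (by positivity : y / 2 ≠ 0) h)
  have hpt : ∀ t, |f t| • g (f t) = (y / 2) ^ a * φ t := by
    intro t
    have hft : 0 < f t := by positivity
    have e1 : -f t - y ^ 2 / (4 * f t) = -(y * Real.cosh t) := by
      simp only [hf, Real.cosh_eq, Real.exp_neg]
      field_simp
      ring
    have e2 : f t ^ a = (y / 2) ^ a * Real.exp (a * t) := by
      simp only [hf]
      rw [Real.mul_rpow (by positivity) (by positivity), ← Real.exp_mul, mul_comm t]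
    rw [abs_of_pos hft, smul_eq_mul, hg]
    simp only
    rw [e1, Real.rpow_sub_one hft.ne', e2]
    simp only [hφ]
    field_simp
  have hint := integral_image_eq_integral_abs_deriv_smul MeasurableSet.univ hder hinj g
  have hintble := (integrableOn_image_iff_integrableOn_abs_deriv_smul
    MeasurableSet.univ hder hinj g).1 (himg ▸ integrableOn_besselG_integrand ha y)
  simp only [hpt, himg, Measure.restrict_univ, integral_const_mul, integrableOn_univ]
    at hint hintble
  have hφi : Integrable φ :=
    (integrable_const_mul_iff (IsUnit.mk0 _ (by positivity)) φ).1 hintble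
  have hK : besselK a y = 1 / 2 * ∫ t, φ t := by
    rw [← intervalIntegral.integral_Iic_add_Ioi (hφi.integrableOn (s := Iic 0)) hφi.integrableOn,
      ← neg_zero, ← integral_comp_neg_Ioi, neg_zero,
      ← integral_add hφi.comp_neg.integrableOn hφi.integrableOn, ← integral_const_mul, besselK]
    refine integral_congr_ae (Eventually.of_forall fun t => ?_)
    simp only [hφ, Real.cosh_neg, Real.cosh_eq (a * t), mul_neg]
    ring
  have hG : besselG a y = (y / 2) ^ a * ∫ t, φ t := hint
  rw [hK, hG, Real.div_rpow hy.le two_pos.le, Real.rpow_sub_one two_ne_zero]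
  have : (2 : ℝ) ^ a ≠ 0 := by positivity
  field_simp

theorem psi_eq_besselG {s : ℝ} (hs : 0 < s) (y : ℝ) :
    psi s y = besselG s y / Real.Gamma s := by
  have hΓ := (Real.Gamma_pos_of_pos hs).ne'
  rcases eq_or_ne y 0 with rfl | hy
  · simp [psi, besselG_zero hs, hΓ]
  · have habs : besselG s |y| = besselG s y := by
      rcases abs_choice y with h | h <;> rw [h]
      exact besselG_neg s y
    rw [psi, if_neg hy, mul_assoc, rpow_mul_besselK hs (abs_pos.2 hy), habs, div_mul_eq_mul_div,
      ← mul_assoc, ← Real.rpow_add two_pos]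
    simp

section FiniteEnergy

variable {b : ℝ} {η : ℝ → ℝ}

theorem integrableOn_rpow_mul_deriv_sq
    (hη : IntegrableOn (fun y => y ^ b * (deriv η y ^ 2 + η y ^ 2)) (Ioi 0)) :
    IntegrableOn (fun y => y ^ b * deriv η y ^ 2) (Ioi 0) := by
  have hm := measurable_deriv η
  refine hη.mono' (Measurable.aestronglyMeasurable (by fun_prop)) ?_
  filter_upwards [ae_restrict_mem measurableSet_Ioi] with y hy
  have hy : (0 : ℝ) < y := hy
  rw [Real.norm_of_nonneg (by positivity)]
  gcongr
  linarith [sq_nonneg (η y)]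

theorem integrableOn_rpow_mul_sq
    (hη : IntegrableOn (fun y => y ^ b * (deriv η y ^ 2 + η y ^ 2)) (Ioi 0)) :
    IntegrableOn (fun y => y ^ b * η y ^ 2) (Ioi 0) :=
  (hη.sub (integrableOn_rpow_mul_deriv_sq hη)).congr
    (Eventually.of_forall fun y => by simp only [Pi.sub_apply]; ring)

/-- A finite weighted energy with an `A₂`-type weight controls the derivative in `L¹_loc`. -/
theorem intervalIntegrable_deriv_of_energy (hb : b < 1)
    (hη : IntegrableOn (fun y => y ^ b * (deriv η y ^ 2 + η y ^ 2)) (Ioi 0))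
    {R : ℝ} (hR : 0 ≤ R) : IntervalIntegrable (deriv η) volume 0 R := by
  rw [intervalIntegrable_iff_integrableOn_Ioc_of_le hR]
  have h1 : IntegrableOn (fun y : ℝ => y ^ (-b)) (Ioc 0 R) :=
    (intervalIntegrable_iff_integrableOn_Ioc_of_le hR).1
      (intervalIntegral.intervalIntegrable_rpow' (by linarith))
  refine (((integrableOn_rpow_mul_deriv_sq hη).mono_set Ioc_subset_Ioi_self).add h1).mono'
    (measurable_deriv η).aestronglyMeasurable ?_
  filter_upwards [ae_restrict_mem measurableSet_Ioc] with y hy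
  have hy : (0 : ℝ) < y := hy.1
  have hp : 0 < y ^ b := by positivity
  simp only [Pi.add_apply, Real.rpow_neg hy.le, Real.norm_eq_abs]
  rw [← sq_abs, ← sub_nonneg]
  have : y ^ b * |deriv η y| ^ 2 + (y ^ b)⁻¹ - |deriv η y| =
      (y ^ b)⁻¹ * ((y ^ b * |deriv η y| - 1 / 2) ^ 2 + 3 / 4) := by
    field_simp
    ring
  rw [this]
  positivity

theorem absolutelyContinuousOnInterval_of_energy (hb : b < 1)
    (hη : IntegrableOn (fun y => y ^ b * (deriv η y ^ 2 + η y ^ 2)) (Ioi 0))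
    (hftc : ∀ y, η y = η 0 + ∫ t in (0 : ℝ)..y, deriv η t) {R : ℝ} (hR : 0 ≤ R) :
    AbsolutelyContinuousOnInterval η 0 R := by
  have h1 : AbsolutelyContinuousOnInterval (fun _ : ℝ => η 0) 0 R :=
    (LipschitzWith.const (η 0)).lipschitzOnWith.absolutelyContinuousOnInterval
  have h2 := (intervalIntegrable_deriv_of_energy hb hη hR).absolutelyContinuousOnInterval_intervalIntegral
    (c := 0) left_mem_uIcc
  rw [funext hftc]
  exact h1.add h2

theorem continuousOn_Ioi_of_energy (hb : b < 1)
    (hη : IntegrableOn (fun y => y ^ b * (deriv η y ^ 2 + η y ^ 2)) (Ioi 0))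
    (hftc : ∀ y, η y = η 0 + ∫ t in (0 : ℝ)..y, deriv η t) : ContinuousOn η (Ioi 0) := by
  intro y hy
  have hy : (0 : ℝ) < y := hy
  have hR : (0 : ℝ) ≤ y + 1 := by linarith
  have := (absolutelyContinuousOnInterval_of_energy hb hη hftc hR).continuousOn
  rw [uIcc_of_le hR] at this
  exact (this.continuousAt (Icc_mem_nhds hy (by linarith))).continuousWithinAt

end FiniteEnergy

/-- The data of a decaying solution `u` on `[0, ∞)` of `(y^b·u')' = lam·y^b·u` with `u 0 = 1`,
together with its flux `F = -y^b·u'`. -/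
structure IsDecayingSolution (b lam : ℝ) (u F : ℝ → ℝ) : Prop where
  continuous : Continuous u
  continuous_flux : Continuous F
  map_zero : u 0 = 1
  hasDerivAt : ∀ y, 0 < y → HasDerivAt u (-((y ^ b)⁻¹ * F y)) y
  hasDerivAt_flux : ∀ y, 0 < y → HasDerivAt F (-(lam * y ^ b * u y)) y
  tendsto : Tendsto u atTop (nhds 0)
  tendsto_flux : Tendsto F atTop (nhds 0)

namespace IsDecayingSolution

variable {b lam : ℝ} {u F η : ℝ → ℝ}

theorem hasDerivAt_neg_flux_mul (h : IsDecayingSolution b lam u F) {y : ℝ} (hy : 0 < y) :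
    HasDerivAt (fun y => -(F y * u y))
      ((y ^ b)⁻¹ * F y ^ 2 + lam * (y ^ b * u y ^ 2)) y :=
  ((h.hasDerivAt_flux y hy).mul (h.hasDerivAt y hy)).neg.congr_deriv (by ring)

theorem energy_density_nonneg (hlam : 0 < lam) {y : ℝ} (hy : 0 < y) :
    0 ≤ (y ^ b)⁻¹ * F y ^ 2 + lam * (y ^ b * u y ^ 2) := by
  positivity

theorem tendsto_neg_flux_mul (h : IsDecayingSolution b lam u F) :
    Tendsto (fun y => -(F y * u y)) atTop (nhds 0) := by
  simpa using (h.tendsto_flux.mul h.tendsto).neg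

theorem continuous_neg_flux_mul (h : IsDecayingSolution b lam u F) :
    Continuous fun y => -(F y * u y) :=
  (h.continuous_flux.mul h.continuous).neg

theorem integrableOn_energy (h : IsDecayingSolution b lam u F) (hlam : 0 < lam) :
    IntegrableOn (fun y => (y ^ b)⁻¹ * F y ^ 2 + lam * (y ^ b * u y ^ 2)) (Ioi 0) :=
  integrableOn_Ioi_deriv_of_nonneg h.continuous_neg_flux_mul.continuousWithinAt
    (fun _ hy => h.hasDerivAt_neg_flux_mul hy) (fun _ hy => energy_density_nonneg hlam hy)
    h.tendsto_neg_flux_mul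

theorem integral_energy (h : IsDecayingSolution b lam u F) (hlam : 0 < lam) :
    ∫ y in Ioi 0, ((y ^ b)⁻¹ * F y ^ 2 + lam * (y ^ b * u y ^ 2)) = F 0 := by
  rw [integral_Ioi_of_hasDerivAt_of_nonneg h.continuous_neg_flux_mul.continuousWithinAt
    (fun _ hy => h.hasDerivAt_neg_flux_mul hy) (fun _ hy => energy_density_nonneg hlam hy)
    h.tendsto_neg_flux_mul, h.map_zero]
  ring

theorem integrableOn_flux_sq (h : IsDecayingSolution b lam u F) (hlam : 0 < lam) :
    IntegrableOn (fun y => (y ^ b)⁻¹ * F y ^ 2) (Ioi 0) := by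
  have hF := h.continuous_flux.measurable
  refine (h.integrableOn_energy hlam).mono' (Measurable.aestronglyMeasurable (by fun_prop)) ?_
  filter_upwards [ae_restrict_mem measurableSet_Ioi] with y hy
  have hy : (0 : ℝ) < y := hy
  rw [Real.norm_of_nonneg (by positivity)]
  have : 0 ≤ lam * (y ^ b * u y ^ 2) := by positivity
  linarith

theorem integrableOn_sq (h : IsDecayingSolution b lam u F) (hlam : 0 < lam) :
    IntegrableOn (fun y => y ^ b * u y ^ 2) (Ioi 0) := by
  have := ((h.integrableOn_energy hlam).sub (h.integrableOn_flux_sq hlam)).const_mul lam⁻¹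
  refine this.congr (Eventually.of_forall fun y => ?_)
  simp only [Pi.sub_apply, add_sub_cancel_left]
  field_simp

theorem integrableOn_mul_self (h : IsDecayingSolution b lam u F) (hlam : 0 < lam) (hb : b < 1)
    (hη : IntegrableOn (fun y => y ^ b * (deriv η y ^ 2 + η y ^ 2)) (Ioi 0))
    (hftc : ∀ y, η y = η 0 + ∫ t in (0 : ℝ)..y, deriv η t) :
    IntegrableOn (fun y => y ^ b * (u y * η y)) (Ioi 0) := by
  have hm := (continuousOn_Ioi_of_energy hb hη hftc).aestronglyMeasurable (μ := volume) measurableSet_Ioi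
  have hu := h.continuous.aestronglyMeasurable (μ := volume.restrict (Ioi 0))
  have hp : AEStronglyMeasurable (fun y : ℝ => y ^ b) (volume.restrict (Ioi 0)) :=
    Measurable.aestronglyMeasurable (by fun_prop)
  refine ((h.integrableOn_sq hlam).add (integrableOn_rpow_mul_sq hη)).mono' (hp.mul (hu.mul hm)) ?_
  filter_upwards [ae_restrict_mem measurableSet_Ioi] with y hy
  have hy : (0 : ℝ) < y := hy
  rw [norm_mul, Real.norm_of_nonneg (by positivity), Pi.add_apply, ← mul_add]
  gcongr
  rw [Real.norm_eq_abs, abs_le]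
  constructor <;> nlinarith [sq_nonneg (u y + η y), sq_nonneg (u y - η y)]

theorem integrableOn_flux_mul (h : IsDecayingSolution b lam u F) (hlam : 0 < lam) {v : ℝ → ℝ}
    (hv : IntegrableOn (fun y => y ^ b * v y ^ 2) (Ioi 0))
    (hm : AEStronglyMeasurable v (volume.restrict (Ioi 0))) :
    IntegrableOn (fun y => F y * v y) (Ioi 0) := by
  have hF := h.continuous_flux.aestronglyMeasurable (μ := volume.restrict (Ioi 0))
  refine ((h.integrableOn_flux_sq hlam).add hv).mono' (hF.mul hm) ?_
  filter_upwards [ae_restrict_mem measurableSet_Ioi] with y hy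
  have hy : (0 : ℝ) < y := hy
  have hp : 0 < y ^ b := by positivity
  rw [Pi.add_apply, Real.norm_eq_abs, abs_le]
  have e1 : (y ^ b)⁻¹ * F y ^ 2 + y ^ b * v y ^ 2 + F y * v y =
      (y ^ b)⁻¹ * ((F y + y ^ b * v y / 2) ^ 2 + 3 / 4 * (y ^ b * v y) ^ 2) := by
    field_simp
    ring
  have e2 : (y ^ b)⁻¹ * F y ^ 2 + y ^ b * v y ^ 2 - F y * v y =
      (y ^ b)⁻¹ * ((F y - y ^ b * v y / 2) ^ 2 + 3 / 4 * (y ^ b * v y) ^ 2) := by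
    field_simp
    ring
  have p1 : 0 ≤ (y ^ b)⁻¹ * ((F y + y ^ b * v y / 2) ^ 2 + 3 / 4 * (y ^ b * v y) ^ 2) := by
    positivity
  have p2 : 0 ≤ (y ^ b)⁻¹ * ((F y - y ^ b * v y / 2) ^ 2 + 3 / 4 * (y ^ b * v y) ^ 2) := by
    positivity
  constructor <;> linarith

/-- Green's formula on `[0, R]`. -/
theorem intervalIntegral_bilinear (h : IsDecayingSolution b lam u F) (hb0 : -1 < b) (hb : b < 1)
    (hη : IntegrableOn (fun y => y ^ b * (deriv η y ^ 2 + η y ^ 2)) (Ioi 0))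
    (hftc : ∀ y, η y = η 0 + ∫ t in (0 : ℝ)..y, deriv η t) {R : ℝ} (hR : 0 ≤ R) :
    ∫ y in (0 : ℝ)..R, (lam * (y ^ b * (u y * η y)) - F y * deriv η y) =
      F 0 * η 0 - F R * η R := by
  set G : ℝ → ℝ := fun y => F 0 + ∫ t in (0 : ℝ)..y, -(lam * t ^ b * u t) with hG
  have hint : ∀ y, IntervalIntegrable (fun t : ℝ => -(lam * t ^ b * u t)) volume 0 y := fun y =>
    (((intervalIntegral.intervalIntegrable_rpow' hb0).const_mul lam).mul_continuousOn
      h.continuous.continuousOn).neg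
  have hGF : ∀ y, 0 ≤ y → G y = F y := fun y hy => by
    simp only [hG]
    rw [intervalIntegral.integral_eq_sub_of_hasDerivAt_of_le hy
      h.continuous_flux.continuousOn (fun x hx => h.hasDerivAt_flux x hx.1) (hint y)]
    ring
  have hGac : AbsolutelyContinuousOnInterval G 0 R := by
    have h1 : AbsolutelyContinuousOnInterval (fun _ : ℝ => F 0) 0 R :=
      (LipschitzWith.const (F 0)).lipschitzOnWith.absolutelyContinuousOnInterval
    exact h1.add ((hint R).absolutelyContinuousOnInterval_intervalIntegral left_mem_uIcc)
  have key := hGac.integral_deriv_mul_eq_sub (absolutelyContinuousOnInterval_of_energy hb hη hftc hR)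
  rw [hGF R hR, hGF 0 le_rfl] at key
  rw [← neg_sub, ← key, ← intervalIntegral.integral_neg]
  refine intervalIntegral.integral_congr_ae (Eventually.of_forall fun y hy => ?_)
  rw [uIoc_of_le hR] at hy
  have hev : G =ᶠ[nhds y] F := by
    filter_upwards [Ioi_mem_nhds hy.1] with x hx
    exact hGF x (le_of_lt hx)
  rw [hev.deriv_eq, (h.hasDerivAt_flux y hy.1).deriv, hGF y hy.1.le]
  ring

theorem integrableOn_bilinear (h : IsDecayingSolution b lam u F) (hlam : 0 < lam) (hb : b < 1)
    (hη : IntegrableOn (fun y => y ^ b * (deriv η y ^ 2 + η y ^ 2)) (Ioi 0))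
    (hftc : ∀ y, η y = η 0 + ∫ t in (0 : ℝ)..y, deriv η t) :
    IntegrableOn (fun y => lam * (y ^ b * (u y * η y)) - F y * deriv η y) (Ioi 0) :=
  ((h.integrableOn_mul_self hlam hb hη hftc).const_mul lam).sub
    (h.integrableOn_flux_mul hlam (integrableOn_rpow_mul_deriv_sq hη)
      (measurable_deriv η).aestronglyMeasurable)

/-- The weak form of the equation: the boundary term at infinity vanishes. -/
theorem integral_bilinear (h : IsDecayingSolution b lam u F) (hlam : 0 < lam)
    (hb0 : -1 < b) (hb : b < 1)
    (hη : IntegrableOn (fun y => y ^ b * (deriv η y ^ 2 + η y ^ 2)) (Ioi 0))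
    (hftc : ∀ y, η y = η 0 + ∫ t in (0 : ℝ)..y, deriv η t) :
    ∫ y in Ioi 0, (lam * (y ^ b * (u y * η y)) - F y * deriv η y) = F 0 * η 0 := by
  set I := ∫ y in Ioi 0, (lam * (y ^ b * (u y * η y)) - F y * deriv η y) with hI
  have hlim : Tendsto (fun R => F R * η R) atTop (nhds (F 0 * η 0 - I)) := by
    refine ((intervalIntegral_tendsto_integral_Ioi 0 (h.integrableOn_bilinear hlam hb hη hftc)
      tendsto_id).const_sub (F 0 * η 0)).congr' ?_
    filter_upwards [eventually_ge_atTop 0] with R hR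
    rw [id, h.intervalIntegral_bilinear hb0 hb hη hftc hR]
    ring
  have hFη : IntegrableOn (fun y => F y * η y) (Ioi 0) :=
    h.integrableOn_flux_mul hlam (integrableOn_rpow_mul_sq hη)
      ((continuousOn_Ioi_of_energy hb hη hftc).aestronglyMeasurable measurableSet_Ioi)
  have h0 := IntegrableAtFilter.eq_zero_of_tendsto (μ := volume)
    ⟨Ioi 0, Ioi_mem_atTop 0, hFη⟩ (fun s hs => by
      obtain ⟨c, hc⟩ := mem_atTop_sets.1 hs
      rw [← top_le_iff, ← Real.volume_Ici (a := c)]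
      exact measure_mono hc) hlim
  linarith

theorem le_energy (h : IsDecayingSolution b lam u F) (hlam : 0 < lam)
    (hb0 : -1 < b) (hb : b < 1)
    (hη : IntegrableOn (fun y => y ^ b * (deriv η y ^ 2 + η y ^ 2)) (Ioi 0))
    (hftc : ∀ y, η y = η 0 + ∫ t in (0 : ℝ)..y, deriv η t) (hη0 : η 0 = 1) :
    F 0 ≤ ∫ y in Ioi 0, y ^ b * (deriv η y ^ 2 + lam * η y ^ 2) := by
  have hB := (h.integrableOn_bilinear hlam hb hη hftc).const_mul 2
  have hE := h.integrableOn_energy hlam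
  have hint : IntegrableOn (fun y => y ^ b * (deriv η y ^ 2 + lam * η y ^ 2)) (Ioi 0) :=
    ((integrableOn_rpow_mul_deriv_sq hη).add ((integrableOn_rpow_mul_sq hη).const_mul lam)).congr
      (Eventually.of_forall fun y => by simp only [Pi.add_apply]; ring)
  calc F 0 = 2 * (F 0 * η 0) - F 0 := by rw [hη0]; ring
    _ = ∫ y in Ioi 0, (2 * (lam * (y ^ b * (u y * η y)) - F y * deriv η y) -
          ((y ^ b)⁻¹ * F y ^ 2 + lam * (y ^ b * u y ^ 2))) := by
        rw [integral_sub hB hE, integral_const_mul, h.integral_bilinear hlam hb0 hb hη hftc,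
          h.integral_energy hlam]
    _ ≤ _ := by
        refine setIntegral_mono_on (hB.sub hE) hint measurableSet_Ioi fun y hy => ?_
        have hy : (0 : ℝ) < y := hy
        have hp : 0 < y ^ b := by positivity
        rw [← sub_nonneg]
        have : y ^ b * (deriv η y ^ 2 + lam * η y ^ 2) -
            (2 * (lam * (y ^ b * (u y * η y)) - F y * deriv η y) -
              ((y ^ b)⁻¹ * F y ^ 2 + lam * (y ^ b * u y ^ 2))) =
            (y ^ b)⁻¹ * (y ^ b * deriv η y + F y) ^ 2 + lam * (y ^ b * (η y - u y) ^ 2) := by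
          field_simp
          ring
        rw [this]
        positivity

end IsDecayingSolution

theorem isDecayingSolution_besselG {s lam : ℝ} (hs0 : 0 < s) (hs1 : s < 1) (hlam : 0 < lam) :
    IsDecayingSolution (1 - 2 * s) lam (fun y => besselG s (Real.sqrt lam * y) / Real.Gamma s)
      (fun y => lam ^ s * (2 : ℝ) ^ (1 - 2 * s) / Real.Gamma s *
        besselG (1 - s) (Real.sqrt lam * y)) := by
  have hs1' : 0 < 1 - s := by linarith
  have hΓ := (Real.Gamma_pos_of_pos hs0).ne'
  have hsq : Real.sqrt lam ^ 2 = lam := Real.sq_sqrt hlam.le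
  have hr : 0 < Real.sqrt lam := Real.sqrt_pos.2 hlam
  have hlin : Tendsto (fun y => Real.sqrt lam * y) atTop atTop := tendsto_id.const_mul_atTop hr
  have hsplit : ∀ x : ℝ, 0 < x → x ^ (1 - 2 * s) = x / (x ^ s) ^ 2 := fun x hx => by
    rw [Real.rpow_sub hx, Real.rpow_one, mul_comm 2 s, Real.rpow_mul hx.le, Real.rpow_two]
  have hpow : ∀ y p : ℝ, 0 < y →
      ((Real.sqrt lam * y) ^ 2 / 4) ^ p = lam ^ p * (y ^ p) ^ 2 / ((2 : ℝ) ^ p) ^ 2 := by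
    intro y p hy
    rw [mul_pow, hsq, Real.div_rpow (by positivity) (by norm_num),
      Real.mul_rpow hlam.le (by positivity), ← Real.rpow_pow_comm hy.le,
      Real.rpow_pow_comm two_pos.le]
    norm_num
  have hder : ∀ a y : ℝ, 0 < a → 0 < y →
      HasDerivAt (fun y => besselG a (Real.sqrt lam * y))
        (-(lam * y / 2) * besselG (a - 1) (Real.sqrt lam * y)) y := by
    intro a y ha hy
    have h1 : HasDerivAt (fun y => Real.sqrt lam * y) (Real.sqrt lam) y := by
      simpa using (hasDerivAt_id y).const_mul (Real.sqrt lam)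
    refine ((hasDerivAt_besselG ha (mul_pos hr hy)).comp y h1).congr_deriv ?_
    linear_combination (-(y / 2) * besselG (a - 1) (Real.sqrt lam * y)) * hsq
  refine ⟨?_, ?_, ?_, fun y hy => ?_, fun y hy => ?_, ?_, ?_⟩
  · exact ((continuous_besselG hs0).comp (continuous_const.mul continuous_id)).div_const _
  · exact ((continuous_besselG hs1').comp (continuous_const.mul continuous_id)).const_mul _
  · simp [besselG_zero hs0, hΓ]
  · refine ((hder s y hs0 hy).div_const (Real.Gamma s)).congr_deriv ?_
    have hrefl := besselG_neg_left (1 - s) (mul_pos hr hy)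
    rw [neg_sub] at hrefl
    rw [hrefl, hpow y _ hy, hsplit y hy, hsplit 2 two_pos, Real.rpow_sub_one hlam.ne',
      Real.rpow_sub_one hy.ne', Real.rpow_sub_one two_ne_zero]
    have : (2 : ℝ) ^ s ≠ 0 := by positivity
    have : y ^ s ≠ 0 := by positivity
    field_simp
  · refine ((hder (1 - s) y hs1' hy).const_mul _).congr_deriv ?_
    rw [show (1 - s - 1 : ℝ) = -s by ring, besselG_neg_left s (mul_pos hr hy), hpow y _ hy,
      hsplit y hy, hsplit 2 two_pos, Real.rpow_neg hlam.le, Real.rpow_neg hy.le,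
      Real.rpow_neg two_pos.le]
    have : (2 : ℝ) ^ s ≠ 0 := by positivity
    have : y ^ s ≠ 0 := by positivity
    have : lam ^ s ≠ 0 := by positivity
    field_simp
  · simpa using ((tendsto_besselG_atTop hs0).comp hlin).div_const (Real.Gamma s)
  · simpa using ((tendsto_besselG_atTop hs1').comp hlin).const_mul
      (lam ^ s * (2 : ℝ) ^ (1 - 2 * s) / Real.Gamma s)

theorem integral_energy_of_even {η : ℝ → ℝ} (heven : ∀ y, η (-y) = η y) (b lam : ℝ) :
    ∫ y, |y| ^ b * (deriv η y ^ 2 + lam * η y ^ 2) =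
      2 * ∫ y in Ioi 0, y ^ b * (deriv η y ^ 2 + lam * η y ^ 2) := by
  have hd : ∀ y, deriv η (-y) ^ 2 = deriv η y ^ 2 := fun y => by
    have := deriv_comp_neg η y
    rw [funext heven] at this
    rw [this, neg_sq]
  rw [← integral_comp_abs]
  refine integral_congr_ae (Eventually.of_forall fun y => ?_)
  rcases abs_choice y with h | h <;> simp only [h, hd, heven]

/-- for `s ∈ (0,1)`, `b = 1 − 2s`, `d_s = 2^{1−2s}·Γ(1−s)/Γ(s)`, `λ > 0`
and `ψ_{s,λ}(y) = ψ_s(√λ·y)`: (a) the weighted energy of `ψ_{s,λ}` equals `2·d_s·λ^s`,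
and (b) every admissible even `η` with `η(0) = 1` has weighted energy at least
`2·d_s·λ^s`; thus `ψ_{s,λ}` is the minimizer. -/
theorem psi_energy_and_minimality (s : ℝ) (hs0 : 0 < s) (hs1 : s < 1)
    (b : ℝ) (hb : b = 1 - 2 * s)
    (d : ℝ) (hd : d = (2 : ℝ) ^ (1 - 2 * s) * Real.Gamma (1 - s) / Real.Gamma s)
    (lam : ℝ) (hlam : 0 < lam) :
    (∫ y : ℝ, |y| ^ b *
        ((deriv (fun t => psi s (Real.sqrt lam * t)) y) ^ 2
          + lam * (psi s (Real.sqrt lam * y)) ^ 2)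
      = 2 * d * lam ^ s) ∧
    (∀ η : ℝ → ℝ,
      (∀ y : ℝ, η (-y) = η y) →
      (∀ᵐ y : ℝ ∂volume, DifferentiableAt ℝ η y) →
      (∀ y : ℝ, η y = η 0 + ∫ t in (0 : ℝ)..y, deriv η t) →
      Integrable (fun y : ℝ => |y| ^ b * ((deriv η y) ^ 2 + (η y) ^ 2)) →
      η 0 = 1 →
      2 * d * lam ^ s ≤ ∫ y : ℝ, |y| ^ b * ((deriv η y) ^ 2 + lam * (η y) ^ 2)) := by
  subst hb hd
  have h := isDecayingSolution_besselG hs0 hs1 hlam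
  have hflux : lam ^ s * (2 : ℝ) ^ (1 - 2 * s) / Real.Gamma s *
      besselG (1 - s) (Real.sqrt lam * 0) =
      (2 : ℝ) ^ (1 - 2 * s) * Real.Gamma (1 - s) / Real.Gamma s * lam ^ s := by
    rw [mul_zero, besselG_zero (by linarith)]
    ring
  constructor
  · simp only [psi_eq_besselG hs0]
    rw [integral_energy_of_even
      (η := fun y => besselG s (Real.sqrt lam * y) / Real.Gamma s)
      (fun y => by rw [mul_neg, besselG_neg]), mul_assoc, ← hflux, ← h.integral_energy hlam]
    congr 1
    refine setIntegral_congr_fun measurableSet_Ioi fun y hy => ?_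
    have hy : (0 : ℝ) < y := hy
    have hp : y ^ (1 - 2 * s) ≠ 0 := by positivity
    simp only [(h.hasDerivAt y hy).deriv]
    field_simp
  · intro η heven _ hftc hint hη0
    rw [integral_energy_of_even heven, mul_assoc, ← hflux]
    gcongr
    refine h.le_energy hlam (by linarith) (by linarith) ?_ hftc hη0
    refine hint.integrableOn.congr_fun (fun y hy => ?_) measurableSet_Ioi
    simp only [abs_of_pos (show (0 : ℝ) < y from hy)]
end

section
/- Let s > 0 be non-integer with ⌊s⌋ even, let 𝔟 = 1 − 2(s − ⌊s⌋), d_s = 2^𝔟·Γ((1+𝔟)/2)·⌊s⌋!/Γ(s), and ⌈s⌉ = ⌊s⌋ + 1. Let Φ = (D_𝔟 + 1)^{⌊s⌋/2} ψ_s, computed pointwise on ℝ∖{0} (Φ is even and smooth on ℝ∖{0}). Then the following virial-type identities hold: ∫_ℝ |y|^𝔟·Φ(y)² dy = (s/⌈s⌉)·2·d_s, and ∫_ℝ |y|^𝔟·Φ'(y)² dy = ((⌈s⌉ − s)/⌈s⌉)·2·d_s. -/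
open MeasureTheory Real Filter Set

/-- The operator `f ↦ D_b f + λ·f`, where `(D_b f)(y) = −f''(y) − (b/y)·f'(y)`. -/
noncomputable def DLam (b lam : ℝ) (f : ℝ → ℝ) : ℝ → ℝ :=
  fun y => -(deriv (deriv f) y) - b / y * deriv f y + lam * f y

/-- The `n`-fold iterate `(D_b + λ)^n f`, computed pointwise. -/
noncomputable def DLamIter (b lam : ℝ) (n : ℕ) (f : ℝ → ℝ) : ℝ → ℝ :=
  (DLam b lam)^[n] f

theorem lintegral_rpow_mul_exp_neg_mul_Ioi {p A : ℝ} (hp : 0 < p) (hA : 0 < A) :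
    ∫⁻ x in Ioi (0 : ℝ), ENNReal.ofReal (x ^ (p - 1) * exp (-(A * x))) =
      ENNReal.ofReal (Gamma p / A ^ p) := by
  have h := Real.integral_rpow_mul_exp_neg_mul_Ioi hp hA
  rw [← ofReal_integral_eq_lintegral_ofReal, h, one_div, inv_rpow hA.le]
  · congr 1
    ring
  · refine Integrable.of_integral_ne_zero ?_
    rw [h]
    have := Gamma_pos_of_pos hp
    positivity
  · filter_upwards [ae_restrict_mem measurableSet_Ioi] with x hx
    have : (0 : ℝ) < x := hx
    positivity

theorem lintegral_exp_mul_sub_mul_exp {p A : ℝ} (hp : 0 < p) (hA : 0 < A) :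
    ∫⁻ t : ℝ, ENNReal.ofReal (exp (p * t - A * exp t)) = ENNReal.ofReal (Gamma p / A ^ p) := by
  have h := lintegral_image_eq_lintegral_abs_deriv_mul (s := univ) MeasurableSet.univ
    (fun x _ => (Real.hasDerivAt_exp x).hasDerivWithinAt) (Real.exp_injective.injOn)
    (fun x => ENNReal.ofReal (x ^ (p - 1) * exp (-(A * x))))
  rw [image_univ, Real.range_exp, lintegral_rpow_mul_exp_neg_mul_Ioi hp hA,
    Measure.restrict_univ] at h
  rw [h]
  congr 1 with t
  rw [← ENNReal.ofReal_mul (abs_nonneg _), abs_of_pos (exp_pos t), ← exp_mul, ← exp_add, ← exp_add]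
  ring_nf

theorem lintegral_exp_div_one_add_exp_rpow {p q : ℝ} (hp : 0 < p) (hq : 0 < q) :
    ∫⁻ v : ℝ, ENNReal.ofReal (exp (p * v) / (1 + exp v) ^ (p + q)) =
      ENNReal.ofReal (Gamma p * Gamma q / Gamma (p + q)) := by
  have hG : 0 < Gamma (p + q) := Gamma_pos_of_pos (by positivity)
  have h1 : ENNReal.ofReal (Gamma p * Gamma q) =
      ∫⁻ t : ℝ, ∫⁻ v : ℝ, ENNReal.ofReal (exp (p * v + (p + q) * t - (1 + exp v) * exp t)) := by
    have e1 := lintegral_exp_mul_sub_mul_exp hp one_pos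
    have e2 := lintegral_exp_mul_sub_mul_exp hq one_pos
    simp only [one_rpow, div_one, one_mul] at e1 e2
    rw [ENNReal.ofReal_mul (Gamma_pos_of_pos hp).le, ← e2, ← lintegral_const_mul _ (by fun_prop)]
    congr 1 with t
    rw [← e1, ← lintegral_mul_const _ (by fun_prop),
      ← lintegral_add_right_eq_self _ t]
    congr 1 with v
    rw [← ENNReal.ofReal_mul (exp_pos _).le, ← exp_add, exp_add v t]
    ring_nf
  have h2 : ENNReal.ofReal (Gamma p * Gamma q) =
      (∫⁻ v : ℝ, ENNReal.ofReal (exp (p * v) / (1 + exp v) ^ (p + q))) *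
        ENNReal.ofReal (Gamma (p + q)) := by
    rw [h1, lintegral_lintegral_swap (Measurable.aemeasurable (by fun_prop)),
      ← lintegral_mul_const _ (by fun_prop)]
    congr 1 with v
    rw [← ENNReal.ofReal_mul (by positivity), div_mul_eq_mul_div, mul_div_assoc,
      ENNReal.ofReal_mul (exp_pos _).le,
      ← lintegral_exp_mul_sub_mul_exp (add_pos hp hq) (by positivity),
      ← lintegral_const_mul _ (by fun_prop)]
    congr 1 with t
    rw [← ENNReal.ofReal_mul (exp_pos _).le, ← exp_add]
    ring_nf
  rw [ENNReal.ofReal_div_of_pos hG, h2, ENNReal.mul_div_cancel_right]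
  · simpa using hG
  · simp

theorem lintegral_comp_two_mul (g : ℝ → ENNReal) :
    ∫⁻ x : ℝ, g x = 2 * ∫⁻ x : ℝ, g (2 * x) := by
  have h := lintegral_image_eq_lintegral_abs_deriv_mul (s := univ) MeasurableSet.univ
    (f := fun x : ℝ => 2 * x) (f' := fun _ => 2)
    (fun x _ => (hasDerivAt_const_mul (2 : ℝ)).hasDerivWithinAt)
    (fun x _ y _ h => by simpa using h) g
  have hr : range (fun x : ℝ => 2 * x) = univ :=
    range_eq_univ.2 fun y => ⟨y / 2, by ring⟩
  rw [image_univ, hr, Measure.restrict_univ, lintegral_const_mul' _ _ (by simp)] at h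
  simpa using h

theorem two_mul_cosh_half_rpow (v c : ℝ) :
    (2 * cosh (v / 2)) ^ c = (1 + exp v) ^ c * exp (-(c / 2 * v)) := by
  have h : 2 * cosh (v / 2) = (1 + exp v) * exp (-(v / 2)) := by
    rw [cosh_eq, add_mul, ← exp_add]
    ring_nf
  rw [h, mul_rpow (by positivity) (by positivity), ← exp_mul]
  ring_nf

theorem lintegral_exp_div_two_cosh_half_rpow {a ν : ℝ} (h1 : 0 < a + ν) (h2 : 0 < a - ν) :
    ∫⁻ v : ℝ, ENNReal.ofReal (exp (ν * v) / (2 * cosh (v / 2)) ^ (2 * a)) =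
      ENNReal.ofReal (Gamma (a + ν) * Gamma (a - ν) / Gamma (2 * a)) := by
  have h := lintegral_exp_div_one_add_exp_rpow h1 h2
  rw [show a + ν + (a - ν) = 2 * a by ring] at h
  rw [← h]
  congr 1 with v
  rw [two_mul_cosh_half_rpow, mul_comm ((1 + exp v) ^ (2 * a)), ← div_div, ← exp_sub]
  ring_nf

theorem lintegral_cosh_rpow_neg {a : ℝ} (ha : 0 < a) :
    ∫⁻ t : ℝ, ENNReal.ofReal (1 / cosh t ^ (2 * a)) =
      ENNReal.ofReal (2 ^ (2 * a) / 2 * (Gamma a ^ 2 / Gamma (2 * a))) := by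
  have h := lintegral_exp_div_two_cosh_half_rpow (a := a) (ν := 0) (by simpa) (by simpa)
  rw [lintegral_comp_two_mul] at h
  simp only [add_zero, sub_zero, ← pow_two, zero_mul, exp_zero] at h
  have h3 : ∫⁻ t : ℝ, ENNReal.ofReal (1 / cosh t ^ (2 * a)) = ENNReal.ofReal (2 ^ (2 * a) / 2) *
      (2 * ∫⁻ t : ℝ, ENNReal.ofReal (1 / (2 * cosh (2 * t / 2)) ^ (2 * a))) := by
    rw [← mul_assoc, show (2 : ENNReal) = ENNReal.ofReal 2 by simp,
      ← ENNReal.ofReal_mul (by positivity), ← lintegral_const_mul' _ _ (by simp)]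
    congr 1 with t
    rw [← ENNReal.ofReal_mul (by positivity), mul_div_cancel_left₀ _ (by norm_num),
      mul_rpow (by norm_num) (cosh_pos t).le]
    congr 1
    have := cosh_pos t
    field_simp
  rw [h3, h, ← ENNReal.ofReal_mul (by positivity)]

/-- The two-sided integral `∫ exp (ν t - y cosh t) dt`, equal to `2 K_ν(y)`. -/
noncomputable def besselE (ν y : ℝ) : ℝ :=
  ∫ t : ℝ, exp (ν * t - y * cosh t)

/-- The integral `∫ exp (ν t - (e^t + q e^{-t}) / 2) dt`, equal to `2 y ^ ν K_ν(y)` at `q = y ^ 2`. -/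
noncomputable def besselH (ν q : ℝ) : ℝ :=
  ∫ t : ℝ, exp (ν * t - (exp t + q * exp (-t)) / 2)

theorem integrable_exp_mul_sub_mul_exp {p A : ℝ} (hp : 0 < p) (hA : 0 < A) :
    Integrable fun t : ℝ => exp (p * t - A * exp t) := by
  rw [← lintegral_ofReal_ne_top_iff_integrable (by fun_prop)
    (Eventually.of_forall fun _ => (exp_pos _).le), lintegral_exp_mul_sub_mul_exp hp hA]
  exact ENNReal.ofReal_ne_top

theorem integrable_besselH (ν : ℝ) {q : ℝ} (hq : 0 < q) :
    Integrable fun t : ℝ => exp (ν * t - (exp t + q * exp (-t)) / 2) := by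
  obtain ⟨k, hk⟩ := exists_nat_gt (-ν)
  refine ((integrable_exp_mul_sub_mul_exp (p := ν + k) (A := 1 / 2) (by linarith)
    (by norm_num)).const_mul (k.factorial * (2 / q) ^ k)).mono' (by fun_prop)
    (Eventually.of_forall fun t => ?_)
  have hx : 0 < q * exp (-t) / 2 := by positivity
  have h := pow_div_factorial_le_exp _ hx.le k
  have h' : exp (-(q * exp (-t) / 2)) ≤ k.factorial * (2 / q) ^ k * exp (k * t) := by
    rw [exp_neg]
    refine (inv_anti₀ (by positivity) h).trans (le_of_eq ?_)
    rw [exp_neg, exp_nat_mul, inv_div, div_eq_mul_inv, mul_assoc, ← mul_pow, ← inv_pow]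
    congr 2
    field_simp
  rw [norm_of_nonneg (exp_pos _).le]
  calc exp (ν * t - (exp t + q * exp (-t)) / 2)
      = exp (ν * t - 1 / 2 * exp t) * exp (-(q * exp (-t) / 2)) := by
        rw [← exp_add]
        ring_nf
    _ ≤ exp (ν * t - 1 / 2 * exp t) * (k.factorial * (2 / q) ^ k * exp (k * t)) := by gcongr
    _ = k.factorial * (2 / q) ^ k * exp ((ν + k) * t - 1 / 2 * exp t) := by
        rw [show (ν + k) * t - 1 / 2 * exp t = (ν * t - 1 / 2 * exp t) + k * t by ring, exp_add]
        ring

theorem besselH_integrand_add_log (ν t : ℝ) {y : ℝ} (hy : 0 < y) :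
    exp (ν * (t + log y) - (exp (t + log y) + y ^ 2 * exp (-(t + log y))) / 2) =
      y ^ ν * exp (ν * t - y * cosh t) := by
  rw [rpow_def_of_pos hy, ← exp_add, cosh_eq, neg_add, exp_add, exp_add, exp_neg (log y), exp_log hy]
  congr 1
  field_simp
  ring

theorem besselH_sq (ν : ℝ) {y : ℝ} (hy : 0 < y) : besselH ν (y ^ 2) = y ^ ν * besselE ν y := by
  rw [besselH, besselE, ← integral_add_right_eq_self _ (log y), ← integral_const_mul]
  simp_rw [besselH_integrand_add_log ν _ hy]

theorem integrable_besselE (ν : ℝ) {y : ℝ} (hy : 0 < y) :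
    Integrable fun t : ℝ => exp (ν * t - y * cosh t) := by
  have h := (integrable_besselH ν (pow_pos hy 2)).comp_add_right (log y)
  simp_rw [besselH_integrand_add_log ν _ hy] at h
  rwa [integrable_const_mul_iff (IsUnit.mk0 _ (rpow_pos_of_pos hy ν).ne')] at h

theorem besselK_eq (ν : ℝ) {y : ℝ} (hy : 0 < y) : besselK ν y = besselE ν y / 2 := by
  have hi := integrable_besselE ν hy
  have h1 : ∫ t : ℝ, exp (-(y * cosh t)) * cosh (ν * t) = besselE ν y := by
    have h2 : ∀ t : ℝ, exp (-(y * cosh t)) * cosh (ν * t) =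
        (exp (ν * t - y * cosh t) + exp (ν * (-t) - y * cosh (-t))) / 2 := fun t => by
      rw [cosh_neg, cosh_eq (ν * t), sub_eq_neg_add, sub_eq_neg_add, exp_add, exp_add]
      ring_nf
    simp_rw [h2]
    rw [integral_div, integral_add hi hi.comp_neg,
      integral_neg_eq_self (fun t : ℝ => exp (ν * t - y * cosh t)), ← besselE]
    ring
  have h3 := integral_comp_abs (f := fun t : ℝ => exp (-(y * cosh t)) * cosh (ν * t))
  have h4 : ∀ t : ℝ, cosh (ν * |t|) = cosh (ν * t) := fun t => by
    rcases abs_choice t with h | h <;> simp [h]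
  simp_rw [cosh_abs, h4, h1] at h3
  rw [besselK, h3]
  ring

theorem hasDerivAt_besselH (ν : ℝ) {q : ℝ} (hq : 0 < q) :
    HasDerivAt (besselH ν) (-besselH (ν - 1) q / 2) q := by
  have h := hasDerivAt_integral_of_dominated_loc_of_deriv_le (μ := volume) (x₀ := q)
    (F := fun q t : ℝ => exp (ν * t - (exp t + q * exp (-t)) / 2))
    (F' := fun q t : ℝ => -exp ((ν - 1) * t - (exp t + q * exp (-t)) / 2) / 2)
    (bound := fun t : ℝ => exp ((ν - 1) * t - (exp t + q / 2 * exp (-t)) / 2))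
    (s := Ioi (q / 2)) (Ioi_mem_nhds (by linarith))
    (Eventually.of_forall fun _ => by fun_prop) (integrable_besselH ν hq) (by fun_prop)
    (Eventually.of_forall fun t x hx => ?_) (integrable_besselH (ν - 1) (by positivity))
    (Eventually.of_forall fun t x hx => ?_)
  · refine h.2.congr_deriv ?_
    rw [integral_div, integral_neg, besselH]
  · rw [norm_div, norm_neg, norm_of_nonneg (exp_pos _).le, Real.norm_ofNat]
    refine (half_le_self (exp_pos _).le).trans (exp_le_exp.2 ?_)
    have : q / 2 * exp (-t) ≤ x * exp (-t) := by
      gcongr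
      exact le_of_lt hx
    linarith
  · have := ((((hasDerivAt_id' x).mul_const (exp (-t))).const_add (exp t)).div_const 2).const_sub
      (ν * t) |>.exp
    refine this.congr_deriv ?_
    rw [show (ν - 1) * t - (exp t + x * exp (-t)) / 2 =
      (ν * t - (exp t + x * exp (-t)) / 2) + -t by ring, exp_add]
    ring

theorem besselH_recurrence (ν : ℝ) {q : ℝ} (hq : 0 < q) :
    besselH (ν + 1) q = q * besselH (ν - 1) q + 2 * ν * besselH ν q := by
  have i1 := (integrable_besselH ν hq).const_mul ν
  have i2 := (integrable_besselH (ν + 1) hq).div_const 2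
  have i3 := (integrable_besselH (ν - 1) hq).const_mul (q / 2)
  have hd : ∀ t : ℝ, HasDerivAt (fun t : ℝ => exp (ν * t - (exp t + q * exp (-t)) / 2))
      (ν * exp (ν * t - (exp t + q * exp (-t)) / 2) -
        exp ((ν + 1) * t - (exp t + q * exp (-t)) / 2) / 2 +
        q / 2 * exp ((ν - 1) * t - (exp t + q * exp (-t)) / 2)) t := fun t => by
    refine (((hasDerivAt_id' t).const_mul ν).sub (((Real.hasDerivAt_exp t).add
      ((hasDerivAt_id' t).neg.exp.const_mul q)).div_const 2)).exp.congr_deriv ?_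
    rw [show (ν + 1) * t - (exp t + q * exp (-t)) / 2 =
      (ν * t - (exp t + q * exp (-t)) / 2) + t by ring,
      show (ν - 1) * t - (exp t + q * exp (-t)) / 2 =
      (ν * t - (exp t + q * exp (-t)) / 2) + -t by ring, exp_add _ t, exp_add _ (-t)]
    simp only [Pi.add_apply, Pi.sub_apply, Pi.neg_apply]
    ring
  have h := integral_eq_zero_of_hasDerivAt_of_integrable hd ((i1.sub i2).add i3)
    (integrable_besselH ν hq)
  rw [integral_add (by exact i1.sub i2) i3, integral_sub i1 i2, integral_const_mul,
    integral_div, integral_const_mul] at h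
  simp only [besselH]
  linarith

theorem ofReal_rpow_mul_besselE_sq (a ν : ℝ) {y : ℝ} (hy : 0 < y) :
    ENNReal.ofReal (y ^ (2 * a - 1) * besselE ν y ^ 2) =
      ∫⁻ t : ℝ, ∫⁻ v : ℝ,
        ENNReal.ofReal (y ^ (2 * a - 1) * exp (ν * v - y * (cosh t + cosh (v - t)))) := by
  have h : ENNReal.ofReal (besselE ν y) =
      ∫⁻ t : ℝ, ENNReal.ofReal (exp (ν * t - y * cosh t)) :=
    ofReal_integral_eq_lintegral_ofReal (integrable_besselE ν hy)
      (Eventually.of_forall fun _ => (exp_pos _).le)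
  have h0 : 0 ≤ besselE ν y := integral_nonneg fun _ => (exp_pos _).le
  have hp : 0 ≤ y ^ (2 * a - 1) := by positivity
  rw [pow_two, ← mul_assoc, ENNReal.ofReal_mul (by positivity), ENNReal.ofReal_mul hp, h, mul_comm,
    ← lintegral_mul_const' _ _ (ENNReal.mul_ne_top ENNReal.ofReal_ne_top (h ▸ ENNReal.ofReal_ne_top))]
  congr 1 with t
  rw [← lintegral_const_mul _ (by fun_prop), ← lintegral_const_mul _ (by fun_prop),
    ← lintegral_sub_right_eq_self _ t]
  congr 1 with v
  rw [← ENNReal.ofReal_mul hp, ← ENNReal.ofReal_mul (exp_pos _).le, mul_left_comm, ← exp_add]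
  ring_nf

theorem lintegral_rpow_mul_besselE_sq {a ν : ℝ} (h1 : 0 < a + ν) (h2 : 0 < a - ν) :
    ∫⁻ y in Ioi (0 : ℝ), ENNReal.ofReal (y ^ (2 * a - 1) * besselE ν y ^ 2) =
      ENNReal.ofReal (Gamma (a + ν) * Gamma (a - ν) *
        (2 ^ (2 * a) / 2 * (Gamma a ^ 2 / Gamma (2 * a)))) := by
  have ha : 0 < a := by linarith
  have hG : 0 < Gamma (2 * a) := Gamma_pos_of_pos (by positivity)
  have hG1 := Gamma_pos_of_pos h1
  have hG2 := Gamma_pos_of_pos h2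
  have hm : Measurable fun p : (ℝ × ℝ) × ℝ => ENNReal.ofReal
      (p.1.1 ^ (2 * a - 1) * exp (ν * p.2 - p.1.1 * (cosh p.1.2 + cosh (p.2 - p.1.2)))) := by
    fun_prop
  have e1 : ∀ t v : ℝ, ∫⁻ y in Ioi (0 : ℝ),
      ENNReal.ofReal (y ^ (2 * a - 1) * exp (ν * v - y * (cosh t + cosh (v - t)))) =
      ENNReal.ofReal (Gamma (2 * a)) *
        (ENNReal.ofReal (exp (ν * v) / (2 * cosh (v / 2)) ^ (2 * a)) *
        ENNReal.ofReal (1 / cosh (t - v / 2) ^ (2 * a))) := fun t v => by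
    have hA : cosh t + cosh (v - t) = 2 * cosh (v / 2) * cosh (t - v / 2) := by
      have ht := cosh_add (v / 2) (t - v / 2)
      have hv := cosh_sub (v / 2) (t - v / 2)
      rw [show v / 2 + (t - v / 2) = t by ring] at ht
      rw [show v / 2 - (t - v / 2) = v - t by ring] at hv
      linarith
    have hA0 : 0 < 2 * cosh (v / 2) * cosh (t - v / 2) := by positivity
    have hsplit : ∀ y : ℝ,
        ENNReal.ofReal (y ^ (2 * a - 1) * exp (ν * v - y * (cosh t + cosh (v - t)))) =
        ENNReal.ofReal (exp (ν * v)) * ENNReal.ofReal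
          (y ^ (2 * a - 1) * exp (-(2 * cosh (v / 2) * cosh (t - v / 2) * y))) := fun y => by
      rw [← ENNReal.ofReal_mul (exp_pos _).le, hA, mul_left_comm (exp _), ← exp_add]
      ring_nf
    simp_rw [hsplit]
    rw [lintegral_const_mul _ (by fun_prop),
      lintegral_rpow_mul_exp_neg_mul_Ioi (by positivity) hA0,
      ← ENNReal.ofReal_mul (exp_pos _).le, ← ENNReal.ofReal_mul (by positivity),
      ← ENNReal.ofReal_mul hG.le, mul_rpow (by positivity) (by positivity)]
    congr 1
    field_simp
  calc ∫⁻ y in Ioi (0 : ℝ), ENNReal.ofReal (y ^ (2 * a - 1) * besselE ν y ^ 2)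
      = ∫⁻ y in Ioi (0 : ℝ), ∫⁻ t : ℝ, ∫⁻ v : ℝ, ENNReal.ofReal
          (y ^ (2 * a - 1) * exp (ν * v - y * (cosh t + cosh (v - t)))) :=
        setLIntegral_congr_fun measurableSet_Ioi
          fun y hy => ofReal_rpow_mul_besselE_sq a ν hy
    _ = ∫⁻ t : ℝ, ∫⁻ v : ℝ, ∫⁻ y in Ioi (0 : ℝ), ENNReal.ofReal
          (y ^ (2 * a - 1) * exp (ν * v - y * (cosh t + cosh (v - t)))) := by
        rw [lintegral_lintegral_swap hm.lintegral_prod_right'.aemeasurable]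
        congr 1 with t
        exact lintegral_lintegral_swap (Measurable.aemeasurable (by fun_prop))
    _ = ∫⁻ v : ℝ, ∫⁻ t : ℝ, ENNReal.ofReal (Gamma (2 * a)) *
        (ENNReal.ofReal (exp (ν * v) / (2 * cosh (v / 2)) ^ (2 * a)) *
        ENNReal.ofReal (1 / cosh (t - v / 2) ^ (2 * a))) := by
        simp_rw [e1]
        exact lintegral_lintegral_swap (Measurable.aemeasurable (by fun_prop))
    _ = ENNReal.ofReal (Gamma (2 * a)) *
        ((∫⁻ v : ℝ, ENNReal.ofReal (exp (ν * v) / (2 * cosh (v / 2)) ^ (2 * a))) *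
        ∫⁻ t : ℝ, ENNReal.ofReal (1 / cosh t ^ (2 * a))) := by
        rw [← lintegral_mul_const _ (by fun_prop), ← lintegral_const_mul _ (by fun_prop)]
        congr 1 with v
        rw [lintegral_const_mul _ (by fun_prop), lintegral_const_mul _ (by fun_prop),
          lintegral_sub_right_eq_self (fun t : ℝ => ENNReal.ofReal (1 / cosh t ^ (2 * a)))]
    _ = _ := by
        rw [lintegral_exp_div_two_cosh_half_rpow h1 h2, lintegral_cosh_rpow_neg ha,
          ← ENNReal.ofReal_mul (by positivity), ← ENNReal.ofReal_mul hG.le]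
        congr 1
        field_simp

theorem integral_rpow_mul_besselE_sq {a ν : ℝ} (h1 : 0 < a + ν) (h2 : 0 < a - ν) :
    ∫ y in Ioi (0 : ℝ), y ^ (2 * a - 1) * besselE ν y ^ 2 =
      Gamma (a + ν) * Gamma (a - ν) * (2 ^ (2 * a) / 2 * (Gamma a ^ 2 / Gamma (2 * a))) := by
  have ha : 0 < a := by linarith
  have hG : 0 < Gamma (2 * a) := Gamma_pos_of_pos (by positivity)
  have hG1 := Gamma_pos_of_pos h1
  have hG2 := Gamma_pos_of_pos h2
  have hm : StronglyMeasurable (besselE ν) := by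
    have : StronglyMeasurable fun p : ℝ × ℝ => exp (ν * p.2 - p.1 * cosh p.2) :=
      Measurable.stronglyMeasurable (by fun_prop)
    exact this.integral_prod_right'
  have hm' := hm.measurable
  rw [integral_eq_lintegral_of_nonneg_ae, lintegral_rpow_mul_besselE_sq h1 h2,
    ENNReal.toReal_ofReal (by positivity)]
  · filter_upwards [ae_restrict_mem measurableSet_Ioi] with y hy
    have : (0 : ℝ) < y := hy
    positivity
  · exact Measurable.aestronglyMeasurable (by fun_prop)

theorem hasDerivAt_besselH_sq (ν : ℝ) {y : ℝ} (hy : y ≠ 0) :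
    HasDerivAt (fun y => besselH ν (y ^ 2)) (-y * besselH (ν - 1) (y ^ 2)) y := by
  have hy2 : 0 < y ^ 2 := by positivity
  refine ((hasDerivAt_besselH ν hy2).comp (h := fun y : ℝ => y ^ 2) y
    (hasDerivAt_pow 2 y)).congr_deriv ?_
  simp
  ring

theorem deriv_of_eq_besselH {f : ℝ → ℝ} {C ν : ℝ} (hf : ∀ y ≠ 0, f y = C * besselH ν (y ^ 2))
    {y : ℝ} (hy : y ≠ 0) : deriv f y = -C * (y * besselH (ν - 1) (y ^ 2)) := by
  have h : f =ᶠ[nhds y] fun y => C * besselH ν (y ^ 2) :=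
    (eventually_ne_nhds hy).mono hf
  rw [h.deriv_eq, ((hasDerivAt_besselH_sq ν hy).const_mul C).deriv]
  ring

theorem DLam_of_eq_besselH (b : ℝ) {f : ℝ → ℝ} {C ν : ℝ}
    (hf : ∀ y ≠ 0, f y = C * besselH ν (y ^ 2)) {y : ℝ} (hy : y ≠ 0) :
    DLam b 1 f y = C * (2 * ν - 1 + b) * besselH (ν - 1) (y ^ 2) := by
  have h : deriv f =ᶠ[nhds y] fun y => -C * (y * besselH (ν - 1) (y ^ 2)) :=
    (eventually_ne_nhds hy).mono fun z hz => deriv_of_eq_besselH hf hz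
  have h2 : deriv (deriv f) y = -C * (1 * besselH (ν - 1) (y ^ 2) +
      y * (-y * besselH (ν - 1 - 1) (y ^ 2))) := by
    rw [h.deriv_eq]
    exact (((hasDerivAt_id' y).mul (hasDerivAt_besselH_sq (ν - 1) hy)).const_mul (-C)).deriv
  have hr := besselH_recurrence (ν - 1) (by positivity : 0 < y ^ 2)
  rw [sub_add_cancel] at hr
  rw [DLam, h2, deriv_of_eq_besselH hf hy, hf y hy, hr]
  field_simp
  ring

theorem psi_eq_besselH (s : ℝ) {y : ℝ} (hy : y ≠ 0) :
    psi s y = 2 ^ (1 - s) / Gamma s / 2 * besselH s (y ^ 2) := by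
  have h := abs_pos.2 hy
  rw [psi, if_neg hy, besselK_eq s h, ← sq_abs, besselH_sq s h]
  ring

theorem DLamIter_psi (b s : ℝ) (k : ℕ) {y : ℝ} (hy : y ≠ 0) :
    DLamIter b 1 k (psi s) y =
      2 ^ (1 - s) / Gamma s / 2 * (∏ i ∈ Finset.range k, (2 * (s - i) - 1 + b)) *
        besselH (s - k) (y ^ 2) := by
  induction k generalizing y with
  | zero => simpa [DLamIter] using psi_eq_besselH s hy
  | succ k ih =>
    rw [DLamIter, Function.iterate_succ_apply',
      DLam_of_eq_besselH b (f := (DLam b 1)^[k] (psi s)) (fun z hz => ih hz) hy,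
      Finset.prod_range_succ, Nat.cast_succ, sub_sub]
    ring

theorem prod_two_mul_sub_mul_factorial (n k : ℕ) (hk : k ≤ n) :
    (∏ i ∈ Finset.range k, (2 * ((n : ℝ) - i))) * (n - k).factorial = 2 ^ k * n.factorial := by
  induction k with
  | zero => simp
  | succ k ih =>
    have h := ih (by omega)
    obtain ⟨j, rfl⟩ : ∃ j, n = k + 1 + j := ⟨n - (k + 1), by omega⟩
    rw [show k + 1 + j - k = j + 1 by omega, Nat.factorial_succ] at h
    rw [show k + 1 + j - (k + 1) = j by omega, Finset.prod_range_succ, pow_succ]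
    push_cast at h ⊢
    linear_combination 2 * h

theorem integral_abs_rpow_mul_besselH_sq {a b ν C : ℝ} (h1 : 0 < a + ν) (h2 : 0 < a - ν)
    (hb : b + 2 * ν = 2 * a - 1) {f : ℝ → ℝ}
    (hf : ∀ y ≠ 0, f y ^ 2 = C ^ 2 * besselH ν (y ^ 2) ^ 2) :
    ∫ y : ℝ, |y| ^ b * f y ^ 2 = 2 * C ^ 2 * (Gamma (a + ν) * Gamma (a - ν) *
      (2 ^ (2 * a) / 2 * (Gamma a ^ 2 / Gamma (2 * a)))) := by
  have h : ∫ y : ℝ, |y| ^ b * f y ^ 2 =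
      ∫ y : ℝ, (fun x => x ^ b * (C ^ 2 * besselH ν (x ^ 2) ^ 2)) |y| := by
    refine integral_congr_ae ?_
    filter_upwards [Measure.ae_ne volume (0 : ℝ)] with y hy
    simp only [sq_abs, hf y hy]
  rw [h, integral_comp_abs (f := fun x => x ^ b * (C ^ 2 * besselH ν (x ^ 2) ^ 2)),
    ← integral_rpow_mul_besselE_sq h1 h2,
    ← integral_const_mul, ← integral_const_mul]
  refine setIntegral_congr_fun measurableSet_Ioi fun y hy => ?_
  have hy' : (0 : ℝ) < y := hy
  rw [besselH_sq ν hy', ← hb, rpow_add hy', two_mul ν, rpow_add hy']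
  ring

/-- virial-type identities. For non-integer `s > 0` with `⌊s⌋` even,
`𝔟 = 1 − 2(s − ⌊s⌋)`, `d_s = 2^𝔟·Γ((1+𝔟)/2)·⌊s⌋!/Γ(s)`, `⌈s⌉ = ⌊s⌋+1` and
`Φ = (D_𝔟 + 1)^{⌊s⌋/2} ψ_s`, one has
`∫ |y|^𝔟·Φ² = (s/⌈s⌉)·2d_s` and `∫ |y|^𝔟·Φ'² = ((⌈s⌉−s)/⌈s⌉)·2d_s`. -/
theorem psi_virial_identities (s : ℝ) (hs : 0 < s) (hni : ∀ n : ℤ, s ≠ n)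
    (hfloor_even : Even ⌊s⌋₊)
    (b : ℝ) (hb : b = 1 - 2 * (s - (⌊s⌋₊ : ℝ)))
    (d : ℝ)
    (hd : d = (2 : ℝ) ^ b * Real.Gamma ((1 + b) / 2) * (Nat.factorial ⌊s⌋₊ : ℝ)
            / Real.Gamma s) :
    (∫ y : ℝ, |y| ^ b * (DLamIter b 1 (⌊s⌋₊ / 2) (psi s) y) ^ 2
        = s / ((⌊s⌋₊ : ℝ) + 1) * (2 * d)) ∧
    (∫ y : ℝ, |y| ^ b * (deriv (DLamIter b 1 (⌊s⌋₊ / 2) (psi s)) y) ^ 2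
        = (((⌊s⌋₊ : ℝ) + 1) - s) / ((⌊s⌋₊ : ℝ) + 1) * (2 * d)) := by
  obtain ⟨m, hm⟩ := hfloor_even
  have hle : (⌊s⌋₊ : ℝ) ≤ s := Nat.floor_le hs.le
  have hlt : s < ⌊s⌋₊ + 1 := Nat.lt_floor_add_one s
  have hm2 : ⌊s⌋₊ / 2 = m := by omega
  rw [hm2]
  generalize ⌊s⌋₊ = n at *
  have hnm : (n : ℝ) = 2 * m := by rw [hm]; push_cast; ring
  have hm0 : (0 : ℝ) ≤ m := Nat.cast_nonneg m
  have hmf : (0 : ℝ) < m.factorial := by positivity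
  have hGs := Gamma_pos_of_pos hs
  set P := ∏ i ∈ Finset.range m, (2 * (s - i) - 1 + b) with hP
  have hPval : P = 2 ^ m * n.factorial / m.factorial := by
    rw [eq_div_iff hmf.ne', ← prod_two_mul_sub_mul_factorial n m (by omega),
      show n - m = m by omega, hP, hb]
    congr 1
    exact Finset.prod_congr rfl fun i _ => by ring
  have hf : ∀ y ≠ 0, DLamIter b 1 m (psi s) y =
      2 ^ (1 - s) / Gamma s / 2 * P * besselH (s - m) (y ^ 2) :=
    fun y hy => DLamIter_psi b s m hy
  have hbs : (1 + b) / 2 = n + 1 - s := by rw [hb]; ring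
  have h2a : (2 : ℝ) ^ (2 * ((m : ℝ) + 1)) = 4 * (2 ^ m) ^ 2 := by
    rw [show 2 * ((m : ℝ) + 1) = ((2 * (m + 1) : ℕ) : ℝ) by push_cast; ring, rpow_natCast]
    ring
  have h2s : (2 : ℝ) ^ (1 - s) = 2 * 2 ^ (-s) := by
    rw [sub_eq_add_neg, rpow_add two_pos, rpow_one]
  have h2b : (2 : ℝ) ^ b = 2 * (2 ^ (-s)) ^ 2 * (2 ^ m) ^ 4 := by
    rw [hb, hnm, show 1 - 2 * (s - 2 * (m : ℝ)) = 1 + -s + -s + ((4 * m : ℕ) : ℝ) by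
      push_cast; ring, rpow_add two_pos, rpow_add two_pos, rpow_add two_pos, rpow_natCast, rpow_one]
    ring
  have hGa : Gamma ((m : ℝ) + 1) = m.factorial := Gamma_nat_eq_factorial m
  have hG2a : Gamma (2 * ((m : ℝ) + 1)) = (n + 1) * n.factorial := by
    rw [show 2 * ((m : ℝ) + 1) = ((n + 1 : ℕ) : ℝ) + 1 by push_cast; rw [hnm]; ring,
      Gamma_nat_eq_factorial, Nat.factorial_succ]
    push_cast
    ring
  constructor
  · rw [integral_abs_rpow_mul_besselH_sq (a := m + 1) (ν := s - m)
      (C := 2 ^ (1 - s) / Gamma s / 2 * P) (by linarith) (by linarith)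
      (by rw [hb, hnm]; ring) (fun y hy => by rw [hf y hy, mul_pow]),
      show (m : ℝ) + 1 + (s - m) = s + 1 by ring,
      show (m : ℝ) + 1 - (s - m) = n + 1 - s by rw [hnm]; ring,
      Gamma_add_one hs.ne', hGa, hG2a, h2a, h2s, hd, h2b, hbs, hPval]
    field_simp
    ring
  · have hderiv : ∀ y ≠ 0, deriv (DLamIter b 1 m (psi s)) y =
        -(2 ^ (1 - s) / Gamma s / 2 * P) * (y * besselH (s - m - 1) (y ^ 2)) :=
      fun y hy => deriv_of_eq_besselH hf hy
    have hshift : ∫ y : ℝ, |y| ^ b * deriv (DLamIter b 1 m (psi s)) y ^ 2 =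
        ∫ y : ℝ, |y| ^ (b + 2) *
          (2 ^ (1 - s) / Gamma s / 2 * P * besselH (s - m - 1) (y ^ 2)) ^ 2 := by
      refine integral_congr_ae ?_
      filter_upwards [Measure.ae_ne volume (0 : ℝ)] with y hy
      rw [hderiv y hy, rpow_add (abs_pos.2 hy), rpow_two, sq_abs]
      ring
    rw [hshift, integral_abs_rpow_mul_besselH_sq (a := m + 1) (ν := s - m - 1)
      (C := 2 ^ (1 - s) / Gamma s / 2 * P) (by linarith) (by linarith)
      (by rw [hb, hnm]; ring) (fun y _ => by rw [mul_pow]),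
      show (m : ℝ) + 1 + (s - m - 1) = s by ring,
      show (m : ℝ) + 1 - (s - m - 1) = n + 1 - s + 1 by rw [hnm]; ring,
      Gamma_add_one (by linarith), hGa, hG2a, h2a, h2s, hd, h2b, hbs, hPval]
    field_simp
    ring
end
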